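/- arXiv:2310.03974 — 2 statements merged into one kernel-verified Lean document; each statement's English description precedes it below -/
import Mathlib

section
/- There exists an absolute constant K'' > 0 such that for every finite set X, every nontrivial increasing family F ⊆ 2^X (i.e. ∅ ≠ F ≠ 2^X) with ℓ(F) ≥ 2, and every integer k ≥ ℓ(F), one has q(F) ≤ p_c^k(F) ≤ K'' · q(F) · (log ℓ(F))². -/
open Finset
open scoped Classical

/-- A family of subsets of a finite ground set is increasing. -/
def Increasing {α : Type*} (F : Finset (Finset α)) : Prop :=
  ∀ A ∈ F, ∀ B : Finset α, A ⊆ B → B ∈ F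

/-- The product measure `μ_p` of a family of subsets:
`μ_p(F) = ∑_{S ∈ F} p^{|S|} (1-p)^{|X \ S|}`. -/
noncomputable def mu {α : Type*} [Fintype α] (p : ℝ) (F : Finset (Finset α)) : ℝ :=
  ∑ S ∈ F, p ^ S.card * (1 - p) ^ (Fintype.card α - S.card)

/-- The minimal elements of a family `F`. -/
def minimals {α : Type*} [DecidableEq α] (F : Finset (Finset α)) : Finset (Finset α) :=
  F.filter fun A => ∀ B ∈ F, B ⊆ A → B = A

/-- `ℓ(F)`: the maximum size of a minimal element of `F`. -/
def ell {α : Type*} [DecidableEq α] (F : Finset (Finset α)) : ℕ :=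
  (minimals F).sup Finset.card

/-- The colored measure `μ_p^k` on families of subsets of `X' = X × [k]`:
a set `S` with all first coordinates distinct gets weight `(p/k)^{|S|}(1-p)^{|X|-|S|}`,
other sets get weight `0`. -/
noncomputable def muk {α : Type*} [Fintype α] [DecidableEq α] (p : ℝ) (k : ℕ)
    (F' : Finset (Finset (α × Fin k))) : ℝ :=
  ∑ S ∈ F', if (S.image Prod.fst).card = S.card then
    (p / (k : ℝ)) ^ S.card * (1 - p) ^ (Fintype.card α - S.card) else 0

/-- `F^rb`: the increasing family on `X × [k]` generated by the rainbow edges of the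
minimal elements of `F`, i.e. all sets containing some `{(x₁,i₁),…,(x_t,i_t)}` with
`{x₁,…,x_t}` a minimal element of `F`, the `xⱼ` distinct and the colors `iⱼ` distinct. -/
noncomputable def rainbowFamily {α : Type*} [Fintype α] [DecidableEq α]
    (F : Finset (Finset α)) (k : ℕ) : Finset (Finset (α × Fin k)) :=
  Finset.univ.filter fun T => ∃ S ⊆ T, (S.image Prod.fst).card = S.card ∧
    (S.image Prod.snd).card = S.card ∧ S.image Prod.fst ∈ minimals F

/-- `F` is `p`-small: there is `G ⊆ 2^X` such that every `T ∈ F` contains some `S ∈ G`,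
and `∑_{S ∈ G} p^{|S|} ≤ 1/2`. -/
def PSmall {α : Type*} [Fintype α] [DecidableEq α] (p : ℝ) (F : Finset (Finset α)) : Prop :=
  ∃ G : Finset (Finset α), (∀ T ∈ F, ∃ S ∈ G, S ⊆ T) ∧ ∑ S ∈ G, p ^ S.card ≤ 1 / 2

/-- The expectation-threshold `q(F) = max {p : F is p-small}`. -/
noncomputable def qexp {α : Type*} [Fintype α] [DecidableEq α] (F : Finset (Finset α)) : ℝ :=
  sSup {p : ℝ | PSmall p F}

/-- The linear functional on polynomials sending a monomial `X^s` to `f (supp s)`.  Polynomials with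
nonnegative coefficients summing to one encode random subsets, multiplication of polynomials
encodes the union of independent random sets, and `setExp f` is the expectation of `f`. -/
noncomputable def setExp {β : Type*} (f : Finset β → ℝ) : MvPolynomial β ℝ →ₗ[ℝ] ℝ :=
  (MvPolynomial.basisMonomials β ℝ).constr ℝ fun s => f s.support

lemma setExp_monomial {β : Type*} (f : Finset β → ℝ) (s : β →₀ ℕ) (c : ℝ) :
    setExp f (MvPolynomial.monomial s c) = c * f s.support := by
  have h : MvPolynomial.monomial s c = c • MvPolynomial.basisMonomials β ℝ s := by
    simp [MvPolynomial.smul_monomial]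
  rw [h, map_smul, setExp, Module.Basis.constr_basis, smul_eq_mul]

lemma setExp_C {β : Type*} (f : Finset β → ℝ) (c : ℝ) :
    setExp f (MvPolynomial.C c) = c * f ∅ := by
  simpa using setExp_monomial f 0 c

lemma setExp_C_mul {β : Type*} (f : Finset β → ℝ) (c : ℝ) (a : MvPolynomial β ℝ) :
    setExp f (MvPolynomial.C c * a) = c * setExp f a := by
  rw [MvPolynomial.C_mul', map_smul, smul_eq_mul]

lemma setExp_X_mul {β : Type*} [DecidableEq β] (f : Finset β → ℝ) (e : β)
    (a : MvPolynomial β ℝ) :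
    setExp f (MvPolynomial.X e * a) = setExp (fun S => f (insert e S)) a := by
  induction a using MvPolynomial.induction_on' with
  | monomial s c =>
    have hs : (Finsupp.single e 1 + s).support = insert e s.support := by
      ext x
      by_cases hx : x = e <;> simp [hx, eq_comm]
    rw [MvPolynomial.X, MvPolynomial.monomial_mul, setExp_monomial, setExp_monomial, hs, one_mul]
  | add p q hp hq => rw [mul_add, map_add, map_add, hp, hq]

lemma setExp_prod_X_mul {β : Type*} [DecidableEq β] (W : Finset β) (f : Finset β → ℝ)
    (a : MvPolynomial β ℝ) :
    setExp f ((∏ e ∈ W, MvPolynomial.X e) * a) = setExp (fun S => f (W ∪ S)) a := by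
  induction W using Finset.induction_on generalizing f with
  | empty => simp
  | insert e W he ih =>
    rw [Finset.prod_insert he, mul_assoc, setExp_X_mul, ih]
    simp only [Finset.insert_union]

lemma setExp_add_left {β : Type*} (f g : Finset β → ℝ) (a : MvPolynomial β ℝ) :
    setExp (fun S => f S + g S) a = setExp f a + setExp g a := by
  induction a using MvPolynomial.induction_on' with
  | monomial s c => simp only [setExp_monomial]; ring
  | add p q hp hq => simp only [map_add, hp, hq]; ring

lemma setExp_const_mul_left {β : Type*} (c : ℝ) (f : Finset β → ℝ) (a : MvPolynomial β ℝ) :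
    setExp (fun S => c * f S) a = c * setExp f a := by
  induction a using MvPolynomial.induction_on' with
  | monomial s d => simp only [setExp_monomial]; ring
  | add p q hp hq => simp only [map_add, hp, hq]; ring

lemma setExp_sum_left {β ι : Type*} (s : Finset ι) (f : ι → Finset β → ℝ)
    (a : MvPolynomial β ℝ) :
    setExp (fun S => ∑ i ∈ s, f i S) a = ∑ i ∈ s, setExp (f i) a := by
  induction a using MvPolynomial.induction_on' with
  | monomial t d => simp only [setExp_monomial, Finset.mul_sum]
  | add p q hp hq => simp only [map_add, hp, hq, Finset.sum_add_distrib]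

lemma setExp_rename {β γ : Type*} [DecidableEq β] [DecidableEq γ] (π : β → γ) (f : Finset γ → ℝ)
    (a : MvPolynomial β ℝ) :
    setExp f (MvPolynomial.rename π a) = setExp (fun S => f (S.image π)) a := by
  induction a using MvPolynomial.induction_on generalizing f with
  | C c => simp [setExp_C]
  | add p q hp hq => simp only [map_add, hp, hq]
  | mul_X p e hp =>
    rw [map_mul, MvPolynomial.rename_X, mul_comm, setExp_X_mul, hp, mul_comm p, setExp_X_mul]
    simp only [Finset.image_insert]

/-- Polynomials with nonnegative coefficients. -/
noncomputable def nonnegPoly (β : Type*) : Subsemiring (MvPolynomial β ℝ) :=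
  Subsemiring.closure ({a | ∃ c : ℝ, 0 ≤ c ∧ a = MvPolynomial.C c} ∪ Set.range MvPolynomial.X)

lemma C_mem_nonnegPoly {β : Type*} {c : ℝ} (hc : 0 ≤ c) : MvPolynomial.C c ∈ nonnegPoly β :=
  Subsemiring.subset_closure (Or.inl ⟨c, hc, rfl⟩)

lemma X_mem_nonnegPoly {β : Type*} (e : β) : (MvPolynomial.X e : MvPolynomial β ℝ) ∈ nonnegPoly β :=
  Subsemiring.subset_closure (Or.inr ⟨e, rfl⟩)

lemma nonnegPoly_mul_pos {β : Type*} [DecidableEq β] {𝒢 : Set (Finset β → ℝ)}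
    (h𝒢 : ∀ f ∈ 𝒢, ∀ e, (fun S => f (insert e S)) ∈ 𝒢) {a b : MvPolynomial β ℝ}
    (ha : a ∈ nonnegPoly β) (hb : ∀ f ∈ 𝒢, 0 ≤ setExp f b) : ∀ f ∈ 𝒢, 0 ≤ setExp f (a * b) := by
  induction ha using Subsemiring.closure_induction generalizing b with
  | mem x hx =>
    intro f hf
    rcases hx with ⟨c, hc, rfl⟩ | ⟨e, rfl⟩
    · rw [setExp_C_mul]; exact mul_nonneg hc (hb f hf)
    · rw [setExp_X_mul]; exact hb _ (h𝒢 f hf e)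
  | zero => simp
  | one => simpa using hb
  | add x y _ _ hx hy =>
    intro f hf
    rw [add_mul, map_add]
    exact add_nonneg (hx hb f hf) (hy hb f hf)
  | mul x y _ _ hx hy =>
    rw [mul_assoc]
    exact hx (hy hb)

lemma setExp_mono {β : Type*} [DecidableEq β] {a : MvPolynomial β ℝ} (ha : a ∈ nonnegPoly β)
    {f g : Finset β → ℝ} (hfg : ∀ S, f S ≤ g S) : setExp f a ≤ setExp g a := by
  have h := nonnegPoly_mul_pos (𝒢 := {f : Finset β → ℝ | ∀ S, 0 ≤ f S}) (b := 1)
    (fun f hf e S => hf _) ha (fun f hf => by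
      rw [← MvPolynomial.C_1, setExp_C, one_mul]; exact hf ∅)
    (fun S => g S + (-1) * f S) (fun S => by have := hfg S; linarith)
  rw [mul_one, setExp_add_left, setExp_const_mul_left] at h
  linarith

/-- Functions that are submodular within every fiber of `π`; by the case `e = e'` such a function is
increasing. -/
def fiberSubmodular {β γ : Type*} [DecidableEq β] (π : β → γ) : Set (Finset β → ℝ) :=
  {f | ∀ S e e', π e = π e' → f (insert e (insert e' S)) + f S ≤ f (insert e S) + f (insert e' S)}

lemma fiberSubmodular_insert {β γ : Type*} [DecidableEq β] {π : β → γ} :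
    ∀ f ∈ fiberSubmodular π, ∀ e, (fun S => f (insert e S)) ∈ fiberSubmodular π := by
  intro f hf e S e₁ e₂ h
  have := hf (insert e S) e₁ e₂ h
  simpa only [Finset.insert_comm e] using this

lemma prod_fiber_le {β γ ι : Type*} [DecidableEq β] {π : β → γ} (x : γ) {r : ℝ} (hr : 0 ≤ r)
    (hr1 : r ≤ 1) (s : Finset ι) (e : ι → β) (he : ∀ i ∈ s, π (e i) = x) :
    ∀ f ∈ fiberSubmodular π,
      0 ≤ setExp f ((1 + MvPolynomial.C r * ∑ i ∈ s, (MvPolynomial.X (e i) - 1)) -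
        ∏ i ∈ s, (MvPolynomial.C (1 - r) + MvPolynomial.C r * MvPolynomial.X (e i))) := by
  classical
  induction s using Finset.induction_on with
  | empty => simp
  | insert i s hi ih =>
    intro f hf
    have h1 := nonnegPoly_mul_pos (a := MvPolynomial.C (1 - r) + MvPolynomial.C r *
        MvPolynomial.X (e i)) fiberSubmodular_insert
      (add_mem (C_mem_nonnegPoly (by linarith)) (mul_mem (C_mem_nonnegPoly hr)
        (X_mem_nonnegPoly _))) (ih fun j hj => he j (mem_insert_of_mem hj)) f hf
    have h2 : 0 ≤ setExp f (MvPolynomial.C (r * r) * ∑ j ∈ s, (MvPolynomial.X (e i) +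
        MvPolynomial.X (e j) - 1 - MvPolynomial.X (e i) * MvPolynomial.X (e j))) := by
      rw [setExp_C_mul, map_sum]
      refine mul_nonneg (mul_nonneg hr hr) (Finset.sum_nonneg fun j hj => ?_)
      have h := hf ∅ (e i) (e j)
        ((he i (mem_insert_self _ _)).trans (he j (mem_insert_of_mem hj)).symm)
      have hX : ∀ (g : Finset β → ℝ) e, setExp g (MvPolynomial.X e) = g {e} := fun g e => by
        have := setExp_X_mul g e (MvPolynomial.C 1)
        rwa [setExp_C, map_one, mul_one, one_mul, insert_empty_eq] at this
      have h1 : setExp f 1 = f ∅ := by simpa using setExp_C f 1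
      rw [map_sub, map_sub, map_add, setExp_X_mul, hX, hX, hX, h1]
      simp only [insert_empty_eq] at h
      linarith
    have hsum : ∑ j ∈ s, (MvPolynomial.X (e i) + MvPolynomial.X (e j) - 1 -
        MvPolynomial.X (e i) * MvPolynomial.X (e j)) =
        - ((MvPolynomial.X (e i) - 1) *
          ∑ j ∈ s, (MvPolynomial.X (e j) - 1) : MvPolynomial β ℝ) := by
      rw [Finset.mul_sum, ← Finset.sum_neg_distrib]
      exact Finset.sum_congr rfl fun j _ => by ring
    rw [hsum] at h2
    have h3 := add_nonneg h1 h2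
    rw [← map_add] at h3
    rw [Finset.prod_insert hi, Finset.sum_insert hi]
    refine h3.trans_eq (congrArg _ ?_)
    simp only [map_mul, map_sub, map_one]
    ring

lemma prod_le_prod_of_fiberSubmodular {β γ ι : Type*} [DecidableEq β] {π : β → γ} (s : Finset ι)
    (a b : ι → MvPolynomial β ℝ) (ha : ∀ i ∈ s, a i ∈ nonnegPoly β)
    (hb : ∀ i ∈ s, b i ∈ nonnegPoly β)
    (hab : ∀ i ∈ s, ∀ f ∈ fiberSubmodular π, 0 ≤ setExp f (b i - a i)) :
    ∀ f ∈ fiberSubmodular π, 0 ≤ setExp f (∏ i ∈ s, b i - ∏ i ∈ s, a i) := by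
  classical
  induction s using Finset.induction_on with
  | empty => simp
  | insert i s hi ih =>
    intro f hf
    have h1 := nonnegPoly_mul_pos fiberSubmodular_insert (ha i (mem_insert_self _ _))
      (ih (fun j hj => ha j (mem_insert_of_mem hj)) (fun j hj => hb j (mem_insert_of_mem hj))
        fun j hj => hab j (mem_insert_of_mem hj)) f hf
    have h2 := nonnegPoly_mul_pos fiberSubmodular_insert
      (Subsemiring.prod_mem _ fun j hj => hb j (mem_insert_of_mem hj))
      (hab i (mem_insert_self _ _)) f hf
    have h3 := add_nonneg h1 h2
    rw [← map_add] at h3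
    rw [Finset.prod_insert hi, Finset.prod_insert hi]
    refine h3.trans_eq (congrArg _ ?_)
    ring

/-- The polynomial encoding the random set containing every element independently with
probability `r`. -/
noncomputable def bernoulliPoly (β : Type*) [Fintype β] (r : ℝ) : MvPolynomial β ℝ :=
  ∏ e, (MvPolynomial.C (1 - r) + MvPolynomial.C r * MvPolynomial.X e)

lemma bernoulliPoly_mem {β : Type*} [Fintype β] {r : ℝ} (hr : 0 ≤ r) (hr1 : r ≤ 1) :
    bernoulliPoly β r ∈ nonnegPoly β :=
  Subsemiring.prod_mem _ fun e _ => add_mem (C_mem_nonnegPoly (by linarith))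
    (mul_mem (C_mem_nonnegPoly hr) (X_mem_nonnegPoly e))

lemma setExp_bernoulliPoly_mul {β : Type*} [Fintype β] [DecidableEq β] (r : ℝ)
    (f : Finset β → ℝ) (a : MvPolynomial β ℝ) :
    setExp f (bernoulliPoly β r * a) = ∑ W : Finset β,
      r ^ W.card * (1 - r) ^ (Fintype.card β - W.card) * setExp (fun S => f (W ∪ S)) a := by
  have h : bernoulliPoly β r = ∑ W : Finset β,
      MvPolynomial.C (r ^ W.card * (1 - r) ^ (Fintype.card β - W.card)) *
        ∏ e ∈ W, MvPolynomial.X e := by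
    rw [bernoulliPoly, Finset.prod_congr rfl fun e _ => add_comm _ _, Finset.prod_add,
      Finset.powerset_univ]
    refine Finset.sum_congr rfl fun W _ => ?_
    rw [Finset.prod_mul_distrib, Finset.prod_const, Finset.prod_const,
      ← Finset.compl_eq_univ_sdiff, Finset.card_compl, map_mul, map_pow, map_pow]
    ring
  rw [h, Finset.sum_mul, map_sum]
  refine Finset.sum_congr rfl fun W _ => ?_
  rw [mul_assoc, setExp_C_mul, setExp_prod_X_mul]

/-- The union of `m` independent `r`-random sets is dominated, for fiberwise submodular functions, by
the random set choosing at most one element in each fiber, each with probability `m * r`. -/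
lemma setExp_bernoulliPoly_pow_le {β γ : Type*} [Fintype β] [DecidableEq β] [Fintype γ]
    [DecidableEq γ] (π : β → γ) {r P : ℝ} (m : ℕ) (hr : 0 ≤ r) (hr1 : r ≤ 1) (hP : P = m * r)
    (hc : ∀ x, ((univ.filter fun e => π e = x).card : ℝ) * P ≤ 1)
    {f : Finset β → ℝ} (hf : f ∈ fiberSubmodular π) :
    setExp f (bernoulliPoly β r ^ m) ≤ setExp f (∏ x : γ,
      (MvPolynomial.C (1 - ((univ.filter fun e => π e = x).card : ℝ) * P) +
        MvPolynomial.C P * ∑ e ∈ univ.filter (fun e => π e = x), MvPolynomial.X e)) := by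
  have hP0 : 0 ≤ P := hP ▸ by positivity
  have hprod : bernoulliPoly β r ^ m = ∏ x : γ, ∏ i ∈ (univ.filter fun e => π e = x) ×ˢ range m,
      (MvPolynomial.C (1 - r) + MvPolynomial.C r * MvPolynomial.X i.1) := by
    rw [bernoulliPoly, ← Finset.prod_pow, ← Finset.prod_fiberwise univ π]
    refine Finset.prod_congr rfl fun x _ => ?_
    rw [Finset.prod_product]
    simp
  rw [hprod, ← sub_nonneg, ← map_sub]
  refine prod_le_prod_of_fiberSubmodular univ _ _ (fun x _ => ?_) (fun x _ => ?_)
    (fun x _ g hg => ?_) f hf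
  · exact Subsemiring.prod_mem _ fun e _ => add_mem (C_mem_nonnegPoly (by linarith))
      (mul_mem (C_mem_nonnegPoly hr) (X_mem_nonnegPoly _))
  · exact add_mem (C_mem_nonnegPoly (by linarith [hc x])) (mul_mem (C_mem_nonnegPoly hP0)
      (Subsemiring.sum_mem _ fun e _ => X_mem_nonnegPoly e))
  · have := prod_fiber_le (π := π) x hr hr1 ((univ.filter fun e => π e = x) ×ˢ range m)
      (fun i => i.1) (fun i hi => by simpa using (mem_product.1 hi).1) g hg
    convert this using 3
    rw [Finset.sum_product, hP]
    simp only [Finset.sum_const, card_range, nsmul_eq_mul, ← Finset.mul_sum,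
      Finset.sum_sub_distrib, map_mul, map_sub, map_one, map_natCast]
    ring

/-- The inclusion-minimal sets among the `S \ W`, `S ∈ H`. -/
noncomputable def fragments {β : Type*} [DecidableEq β] (H : Finset (Finset β)) (W : Finset β) :
    Finset (Finset β) :=
  minimals (H.image fun S => S \ W)

lemma mem_minimals {β : Type*} [DecidableEq β] {F : Finset (Finset β)} {A : Finset β} :
    A ∈ minimals F ↔ A ∈ F ∧ ∀ B ∈ F, B ⊆ A → B = A := by
  simp [minimals]

lemma exists_minimals_subset {β : Type*} [DecidableEq β] {F : Finset (Finset β)} {A : Finset β}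
    (hA : A ∈ F) : ∃ B ∈ minimals F, B ⊆ A := by
  obtain ⟨B, hBA, hB⟩ := F.exists_le_minimal hA
  exact ⟨B, mem_minimals.2 ⟨hB.prop, fun C hC hCB => hB.eq_of_le hC hCB⟩, hBA⟩

lemma mem_fragments {β : Type*} [DecidableEq β] {H : Finset (Finset β)} {W T : Finset β} :
    T ∈ fragments H W ↔ (∃ S ∈ H, S \ W = T) ∧ ∀ S ∈ H, S \ W ⊆ T → S \ W = T := by
  simp [fragments, mem_minimals]

lemma exists_superset_fragments {β : Type*} [DecidableEq β] {H : Finset (Finset β)} {n : ℕ}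
    (hH : ∀ S ∈ H, S.card ≤ n) (Z : Finset β) :
    ∃ D : Finset β, D.card ≤ n ∧ ∀ W T, T ∈ fragments H W → W ∪ T = Z → T ⊆ D := by
  by_cases h : ∃ S ∈ H, S ⊆ Z
  · obtain ⟨S, hS, hSZ⟩ := h
    refine ⟨S, hH S hS, fun W T hT hZ => ?_⟩
    rw [← (mem_fragments.1 hT).2 S hS]
    · exact sdiff_subset
    · exact sdiff_le_iff.2 (hSZ.trans hZ.ge)
  · refine ⟨∅, by simp, fun W T hT hZ => (h ?_).elim⟩
    obtain ⟨S, hS, hST⟩ := (mem_fragments.1 hT).1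
    exact ⟨S, hS, (sdiff_le_iff.1 hST.le).trans hZ.le⟩

lemma sum_bernoulli_weight {β : Type*} [Fintype β] (q : ℝ) :
    ∑ W : Finset β, q ^ W.card * (1 - q) ^ (Fintype.card β - W.card) = 1 := by
  rw [Fintype.sum_pow_mul_eq_add_pow]
  simp

lemma sum_fragments_cost_le {β : Type*} [Fintype β] [DecidableEq β] {H : Finset (Finset β)}
    {t : ℕ} (hH : ∀ S ∈ H, S.card ≤ 2 * t) {p q : ℝ} (hp : 0 ≤ p) (hq : q = 64 * p)
    (hq1 : q ≤ 1) :
    ∑ W : Finset β, q ^ W.card * (1 - q) ^ (Fintype.card β - W.card) *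
      ∑ T ∈ (fragments H W).filter (fun T => t ≤ T.card), p ^ T.card ≤ (1 / 16) ^ t := by
  have hq0 : 0 ≤ q := by linarith
  set μ : Finset β → ℝ := fun W => q ^ W.card * (1 - q) ^ (Fintype.card β - W.card) with hμ
  have hμ0 : ∀ W, 0 ≤ μ W := fun W =>
    mul_nonneg (pow_nonneg hq0 _) (pow_nonneg (by linarith) _)
  choose D hDcard hD using exists_superset_fragments hH
  have hdisj : ∀ W, ∀ T ∈ fragments H W, Disjoint W T := by
    intro W T hT
    obtain ⟨S, -, rfl⟩ := (mem_fragments.1 hT).1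
    exact disjoint_sdiff
  have hweight : ∀ W, ∀ T ∈ fragments H W,
      μ W * p ^ T.card ≤ μ (W ∪ T) * (1 / 64) ^ T.card := by
    intro W T hT
    have hc := card_union_of_disjoint (hdisj W T hT)
    have hle : W.card + T.card ≤ Fintype.card β := hc ▸ card_le_univ _
    have hexp : Fintype.card β - W.card = (Fintype.card β - (W ∪ T).card) + T.card := by omega
    have hpq : p = q * (1 / 64) := by rw [hq]; ring
    have h1 : (1 - q) ^ T.card ≤ 1 := pow_le_one₀ (by linarith) (by linarith)
    calc μ W * p ^ T.card = (μ (W ∪ T) * (1 / 64) ^ T.card) * (1 - q) ^ T.card := by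
          simp only [hμ, hexp, hc, pow_add]
          rw [hpq, mul_pow]
          ring
      _ ≤ _ := mul_le_of_le_one_right (mul_nonneg (hμ0 _) (by positivity)) h1
  set U : Finset β → Finset (Finset β) := fun W =>
    (fragments H W).filter (fun T => t ≤ T.card) with hU
  calc ∑ W : Finset β, μ W * ∑ T ∈ U W, p ^ T.card
      ≤ ∑ W : Finset β, ∑ T ∈ U W, μ (W ∪ T) * (1 / 64) ^ T.card := by
        refine Finset.sum_le_sum fun W _ => ?_
        rw [Finset.mul_sum]
        exact Finset.sum_le_sum fun T hT => hweight W T (mem_filter.1 hT).1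
    _ = ∑ x ∈ (univ : Finset (Finset β)).sigma U, μ (x.1 ∪ x.2) * (1 / 64) ^ x.2.card := by
        rw [Finset.sum_sigma]
    _ = ∑ x ∈ ((univ : Finset (Finset β)).sigma U).image
          (fun x => (⟨x.1 ∪ x.2, x.2⟩ : Σ _ : Finset β, Finset β)),
          μ x.1 * (1 / 64) ^ x.2.card := by
        rw [Finset.sum_image]
        rintro ⟨W, T⟩ h ⟨W', T'⟩ h' heq
        simp only [coe_sigma, Set.mem_sigma_iff, mem_coe, mem_univ, true_and, hU,
          mem_filter] at h h'
        simp only [Sigma.mk.injEq, heq_eq_eq] at heq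
        obtain ⟨h1, rfl⟩ := heq
        have hW : W = (W ∪ T) \ T := (union_sdiff_cancel_right (hdisj W T h.1)).symm
        have hW' : W' = (W' ∪ T) \ T := (union_sdiff_cancel_right (hdisj W' T h'.1)).symm
        rw [hW, hW', h1]
    _ ≤ ∑ x ∈ (univ : Finset (Finset β)).sigma
          (fun Z => (D Z).powerset.filter (fun T => t ≤ T.card)),
          μ x.1 * (1 / 64) ^ x.2.card := by
        refine Finset.sum_le_sum_of_subset_of_nonneg ?_ fun x _ _ =>
          mul_nonneg (hμ0 _) (by positivity)
        intro x hx
        obtain ⟨⟨W, T⟩, h, rfl⟩ := mem_image.1 hx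
        simp only [mem_sigma, mem_univ, true_and, hU, mem_filter, mem_powerset] at h ⊢
        exact ⟨hD _ W T h.1 rfl, h.2⟩
    _ = ∑ Z : Finset β, μ Z * ∑ T ∈ (D Z).powerset.filter (fun T => t ≤ T.card),
          (1 / 64) ^ T.card := by
        rw [Finset.sum_sigma]
        simp only [Finset.mul_sum]
    _ ≤ ∑ Z : Finset β, μ Z * (1 / 16) ^ t := by
        refine Finset.sum_le_sum fun Z _ => mul_le_mul_of_nonneg_left ?_ (hμ0 Z)
        calc ∑ T ∈ (D Z).powerset.filter (fun T => t ≤ T.card), ((1 : ℝ) / 64) ^ T.card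
            ≤ ∑ T ∈ (D Z).powerset.filter (fun T => t ≤ T.card), ((1 : ℝ) / 64) ^ t :=
              Finset.sum_le_sum fun T hT =>
                pow_le_pow_of_le_one (by norm_num) (by norm_num) (mem_filter.1 hT).2
          _ ≤ 2 ^ (2 * t) * (1 / 64) ^ t := by
              rw [Finset.sum_const, nsmul_eq_mul]
              refine mul_le_mul_of_nonneg_right ?_ (by positivity)
              have h := (card_filter_le (D Z).powerset (fun T => t ≤ T.card)).trans_eq
                (card_powerset (D Z))
              exact_mod_cast h.trans (Nat.pow_le_pow_right (by norm_num) (hDcard Z))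
          _ = (1 / 16) ^ t := by
              rw [pow_mul, ← mul_pow]
              norm_num
    _ = (1 / 16) ^ t := by
        rw [← Finset.sum_mul, sum_bernoulli_weight, one_mul]

/-- The indicator function of the increasing family generated by `H`. -/
noncomputable def upIndicator {β : Type*} (H : Finset (Finset β)) (S : Finset β) : ℝ :=
  if ∃ T ∈ H, T ⊆ S then 1 else 0

/-- The core of the Park–Pham theorem: the union of `m` independent `64p`-random sets contains a
set of `H` with probability at least `κ - 1/15`, if all sets in `H` have size less than `2 ^ m` and
every cover of `H` has cost at least `κ`. -/
lemma sub_le_setExp_upIndicator {β : Type*} [Fintype β] [DecidableEq β] {p q : ℝ} (hp : 0 ≤ p)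
    (hq : q = 64 * p) (hq1 : q ≤ 1) (m : ℕ) (H : Finset (Finset β))
    (hH : ∀ S ∈ H, S.card < 2 ^ m) (κ : ℝ)
    (hκ : ∀ G : Finset (Finset β), (∀ S ∈ H, ∃ T ∈ G, T ⊆ S) → κ ≤ ∑ T ∈ G, p ^ T.card) :
    κ - (1 - (1 / 16) ^ m) / 15 ≤ setExp (upIndicator H) (bernoulliPoly β q ^ m) := by
  have hq0 : 0 ≤ q := by linarith
  induction m generalizing H κ with
  | zero =>
    have h1 := hκ H fun S hS => ⟨S, hS, subset_rfl⟩
    have h2 : ∀ S ∈ H, S = ∅ := fun S hS => by simpa using hH S hS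
    rw [pow_zero, pow_zero, ← MvPolynomial.C_1, setExp_C, one_mul, upIndicator]
    rcases H.eq_empty_or_nonempty with rfl | ⟨S, hS⟩
    · simpa using h1
    · have hS0 := h2 S hS
      subst hS0
      have hH0 : H = {∅} := Finset.eq_singleton_iff_unique_mem.2 ⟨hS, h2⟩
      rw [if_pos ⟨∅, hS, subset_rfl⟩]
      simpa [hH0] using h1
  | succ m ih =>
    rw [pow_succ' (bernoulliPoly β q), setExp_bernoulliPoly_mul]
    have hμ0 : ∀ W : Finset β, 0 ≤ q ^ W.card * (1 - q) ^ (Fintype.card β - W.card) := fun W =>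
      mul_nonneg (pow_nonneg hq0 _) (pow_nonneg (by linarith) _)
    have hcost := sum_fragments_cost_le (H := H) (t := 2 ^ m)
      (fun S hS => by have := hH S hS; rw [pow_succ'] at this; exact this.le) hp hq hq1
    have hstep : ∀ W : Finset β, κ - ∑ T ∈ (fragments H W).filter (fun T => 2 ^ m ≤ T.card),
        p ^ T.card - (1 - (1 / 16) ^ m) / 15 ≤
          setExp (fun S => upIndicator H (W ∪ S)) (bernoulliPoly β q ^ m) := by
      intro W
      refine (ih ((fragments H W).filter (fun T => T.card < 2 ^ m))
        (fun S hS => (mem_filter.1 hS).2) _ fun G hG => ?_).trans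
        (setExp_mono (Subsemiring.pow_mem _ (bernoulliPoly_mem hq0 hq1) m) fun S => ?_)
      · have h := hκ (G ∪ (fragments H W).filter (fun T => 2 ^ m ≤ T.card)) fun S hS => by
          obtain ⟨T, hT, hTS⟩ := exists_minimals_subset
            (mem_image_of_mem (fun S => S \ W) hS)
          by_cases hc : T.card < 2 ^ m
          · obtain ⟨T', hT', hTT'⟩ := hG T (mem_filter.2 ⟨hT, hc⟩)
            exact ⟨T', mem_union_left _ hT', hTT'.trans (hTS.trans sdiff_subset)⟩
          · exact ⟨T, mem_union_right _ (mem_filter.2 ⟨hT, not_lt.1 hc⟩),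
              hTS.trans sdiff_subset⟩
        have h2 : ∑ T ∈ G ∪ (fragments H W).filter (fun T => 2 ^ m ≤ T.card), p ^ T.card ≤
            ∑ T ∈ G, p ^ T.card +
              ∑ T ∈ (fragments H W).filter (fun T => 2 ^ m ≤ T.card), p ^ T.card := by
          rw [← Finset.sum_union_inter]
          exact le_add_of_nonneg_right (Finset.sum_nonneg fun T _ => pow_nonneg hp _)
        linarith
      · unfold upIndicator
        by_cases h : ∃ T ∈ (fragments H W).filter (fun T => T.card < 2 ^ m), T ⊆ S
        · obtain ⟨T, hT, hTS⟩ := h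
          obtain ⟨S', hS', rfl⟩ := (mem_fragments.1 (mem_filter.1 hT).1).1
          rw [if_pos ⟨_, hT, hTS⟩, if_pos ⟨S', hS', sdiff_le_iff.1 hTS⟩]
        · rw [if_neg h]
          split_ifs <;> norm_num
    have hsum := Finset.sum_le_sum fun W (_ : W ∈ (univ : Finset (Finset β))) =>
      mul_le_mul_of_nonneg_left (hstep W) (hμ0 W)
    refine le_trans ?_ hsum
    simp only [mul_sub, Finset.sum_sub_distrib, ← Finset.sum_mul, sum_bernoulli_weight, one_mul]
    have hpow : ((1 : ℝ) / 16) ^ 2 ^ m ≤ (1 / 16) ^ (m + 1) :=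
      pow_le_pow_of_le_one (by norm_num) (by norm_num) m.lt_two_pow_self
    rw [pow_succ] at hpow ⊢
    linarith

lemma upIndicator_mem_fiberSubmodular {β γ : Type*} [DecidableEq β] {π : β → γ}
    {H : Finset (Finset β)} (hH : ∀ T ∈ H, Set.InjOn π T) :
    upIndicator H ∈ fiberSubmodular π := by
  have hmono : ∀ A B : Finset β, A ⊆ B → upIndicator H A ≤ upIndicator H B := by
    intro A B hAB
    unfold upIndicator
    split_ifs with h1 h2 h2
    · exact le_rfl
    · obtain ⟨T, hT, hTA⟩ := h1
      exact (h2 ⟨T, hT, hTA.trans hAB⟩).elim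
    · norm_num
    · exact le_rfl
  intro S e e' he
  by_cases h : ∃ T ∈ H, T ⊆ insert e (insert e' S)
  · have h1 : upIndicator H (insert e (insert e' S)) = 1 := if_pos h
    obtain ⟨T, hT, hTS⟩ := h
    by_cases heT : e ∈ T
    · have hsub : T ⊆ insert e S := by
        intro x hx
        rcases mem_insert.1 (hTS hx) with rfl | hx'
        · exact mem_insert_self _ _
        · rcases mem_insert.1 hx' with rfl | hx''
          · rw [hH T hT heT hx he]
            exact mem_insert_self _ _
          · exact mem_insert_of_mem hx''
      have h2 : upIndicator H (insert e S) = 1 := if_pos ⟨T, hT, hsub⟩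
      linarith [hmono S (insert e' S) (subset_insert _ _)]
    · have hsub : T ⊆ insert e' S := (subset_insert_iff_of_notMem heT).1 hTS
      have h2 : upIndicator H (insert e' S) = 1 := if_pos ⟨T, hT, hsub⟩
      linarith [hmono S (insert e S) (subset_insert _ _)]
  · have h1 : upIndicator H (insert e (insert e' S)) = 0 := if_neg h
    have h2 := hmono S (insert e' S) (subset_insert _ _)
    have h3 := hmono (insert e S) (insert e (insert e' S))
      (insert_subset_insert _ (subset_insert _ _))
    have h4 : 0 ≤ upIndicator H (insert e S) := by unfold upIndicator; split_ifs <;> norm_num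
    linarith

lemma setExp_bernoulliPoly {β : Type*} [Fintype β] [DecidableEq β] (r : ℝ) (f : Finset β → ℝ) :
    setExp f (bernoulliPoly β r) = ∑ W : Finset β,
      r ^ W.card * (1 - r) ^ (Fintype.card β - W.card) * f W := by
  rw [← mul_one (bernoulliPoly β r), setExp_bernoulliPoly_mul]
  refine Finset.sum_congr rfl fun W _ => ?_
  rw [← MvPolynomial.C_1, setExp_C, one_mul, union_empty]

lemma setExp_bernoulliPoly_subset {β : Type*} [Fintype β] [DecidableEq β] (r : ℝ)
    (T : Finset β) :
    setExp (fun S => if T ⊆ S then 1 else 0) (bernoulliPoly β r) = r ^ T.card := by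
  rw [setExp_bernoulliPoly]
  simp only [mul_ite, mul_one, mul_zero]
  rw [← Finset.sum_filter]
  have himg : univ.filter (fun S => T ⊆ S) = Tᶜ.powerset.image (fun V => T ∪ V) := by
    ext S
    simp only [mem_filter, mem_univ, true_and, mem_image, mem_powerset]
    constructor
    · intro h
      exact ⟨S \ T, fun x hx => by simpa using (mem_sdiff.1 hx).2, union_sdiff_of_subset h⟩
    · rintro ⟨V, -, rfl⟩
      exact subset_union_left
  have hdisj : ∀ V ∈ Tᶜ.powerset, Disjoint T V := fun V hV =>
    disjoint_compl_right.mono_right (mem_powerset.1 hV)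
  rw [himg, Finset.sum_image]
  · have : ∀ V ∈ Tᶜ.powerset, r ^ (T ∪ V).card * (1 - r) ^ (Fintype.card β - (T ∪ V).card) =
        r ^ T.card * (r ^ V.card * (1 - r) ^ (Tᶜ.card - V.card)) := by
      intro V hV
      rw [card_union_of_disjoint (hdisj V hV), card_compl, pow_add, Nat.sub_sub]
      ring
    rw [Finset.sum_congr rfl this, ← Finset.mul_sum, Finset.sum_pow_mul_eq_add_pow]
    simp
  · intro V hV V' hV' h
    have h1 : V = (T ∪ V) \ T := (union_sdiff_cancel_left (hdisj V hV)).symm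
    have h2 : V' = (T ∪ V') \ T := (union_sdiff_cancel_left (hdisj V' hV')).symm
    rw [h1, h2]
    exact congrArg (· \ T) h

/-- The polynomial encoding the random set that contains, independently for every `x`, one uniformly
random pair `(x, i)` with probability `p`, and none otherwise. -/
noncomputable def coloredPoly (α : Type*) [Fintype α] [DecidableEq α] (k : ℕ) (p : ℝ) :
    MvPolynomial (α × Fin k) ℝ :=
  ∏ x : α, (MvPolynomial.C (1 - p) + MvPolynomial.C (p / k) * ∑ i : Fin k, MvPolynomial.X (x, i))

lemma coloredPoly_mem {α : Type*} [Fintype α] [DecidableEq α] (k : ℕ) {p : ℝ} (hp : 0 ≤ p)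
    (hp1 : p ≤ 1) : coloredPoly α k p ∈ nonnegPoly (α × Fin k) :=
  Subsemiring.prod_mem _ fun _ _ => add_mem (C_mem_nonnegPoly (by linarith))
    (mul_mem (C_mem_nonnegPoly (by positivity)) (Subsemiring.sum_mem _ fun _ _ =>
      X_mem_nonnegPoly _))

/-- The set of pairs `(x, i)` with `g x = some i`. -/
noncomputable def partialGraph {α : Type*} [Fintype α] {k : ℕ} (g : α → Option (Fin k)) :
    Finset (α × Fin k) :=
  univ.filter fun e => g e.1 = some e.2

lemma prod_partialGraph {α M : Type*} [Fintype α] [CommMonoid M] {k : ℕ}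
    (g : α → Option (Fin k)) (h : α × Fin k → M) :
    ∏ e ∈ partialGraph g, h e = ∏ x, (g x).elim 1 fun i => h (x, i) := by
  rw [partialGraph, Finset.prod_filter, Fintype.prod_prod_type]
  refine Finset.prod_congr rfl fun x _ => ?_
  cases hx : g x with
  | none => exact Finset.prod_eq_one fun i _ => if_neg (by simp [hx])
  | some i =>
    rw [Finset.prod_eq_single i (fun j _ hj => if_neg (by simp [hx, hj.symm])) (by simp)]
    exact if_pos hx

lemma card_partialGraph {α : Type*} [Fintype α] {k : ℕ} (g : α → Option (Fin k)) :
    Fintype.card α - (partialGraph g).card = (univ.filter fun x => g x = none).card := by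
  have h1 : (partialGraph g).card = (univ.filter fun x => ¬ g x = none).card := by
    rw [← Finset.card_image_of_injOn (s := partialGraph g) (f := Prod.fst)]
    · congr 1
      ext x
      simp [partialGraph, Option.ne_none_iff_exists', ← Option.isSome_iff_exists]
    · rintro ⟨x, i⟩ h ⟨y, j⟩ h' heq
      simp only [partialGraph, coe_filter, mem_univ, true_and, Set.mem_ofPred_eq] at h h' heq
      subst heq
      simp_all
  have h2 := Finset.card_filter_add_card_filter_not (s := (univ : Finset α))
    (fun x => g x = none)
  rw [card_univ] at h2
  omega

lemma muk_eq_setExp {α : Type*} [Fintype α] [DecidableEq α] (p : ℝ) (k : ℕ)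
    (F' : Finset (Finset (α × Fin k))) :
    muk p k F' = setExp (fun S => if S ∈ F' then 1 else 0) (coloredPoly α k p) := by
  have hterm : ∀ x : α, (MvPolynomial.C (1 - p) + MvPolynomial.C (p / k) *
      ∑ i : Fin k, MvPolynomial.X (x, i) : MvPolynomial (α × Fin k) ℝ) =
      ∑ o : Option (Fin k), o.elim (MvPolynomial.C (1 - p))
        fun i => MvPolynomial.C (p / k) * MvPolynomial.X (x, i) := by
    intro x
    rw [Fintype.sum_option, Finset.mul_sum]
    rfl
  have hprod : ∀ g : α → Option (Fin k), ∏ x, ((g x).elim (MvPolynomial.C (1 - p))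
      fun i => MvPolynomial.C (p / k) * MvPolynomial.X (x, i) : MvPolynomial (α × Fin k) ℝ) =
      MvPolynomial.C ((p / k) ^ (partialGraph g).card *
        (1 - p) ^ (Fintype.card α - (partialGraph g).card)) *
        ∏ e ∈ partialGraph g, MvPolynomial.X e := by
    intro g
    have h1 : (MvPolynomial.C (p / k) : MvPolynomial (α × Fin k) ℝ) ^ (partialGraph g).card *
        ∏ e ∈ partialGraph g, MvPolynomial.X e = ∏ x, (g x).elim 1 fun i =>
          MvPolynomial.C (p / k) * MvPolynomial.X (x, i) := by
      rw [← Finset.prod_const, ← Finset.prod_mul_distrib, prod_partialGraph]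
    have h2 : (MvPolynomial.C (1 - p) : MvPolynomial (α × Fin k) ℝ) ^
        (Fintype.card α - (partialGraph g).card) =
        ∏ x, if g x = none then MvPolynomial.C (1 - p) else 1 := by
      rw [card_partialGraph, ← Finset.prod_const, Finset.prod_filter]
    rw [map_mul, map_pow, map_pow, mul_right_comm, h1, h2, ← Finset.prod_mul_distrib]
    refine Finset.prod_congr rfl fun x _ => ?_
    cases g x <;> simp
  rw [coloredPoly, Finset.prod_congr rfl fun x _ => hterm x, Finset.prod_univ_sum, map_sum]
  simp only [hprod, setExp_C_mul]
  have hX : ∀ S : Finset (α × Fin k),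
      setExp (fun S => if S ∈ F' then (1 : ℝ) else 0) (∏ e ∈ S, MvPolynomial.X e) =
        if S ∈ F' then 1 else 0 := by
    intro S
    rw [← mul_one (∏ e ∈ S, MvPolynomial.X e), setExp_prod_X_mul, ← MvPolynomial.C_1, setExp_C,
      one_mul, union_empty]
  simp only [hX, mul_ite, mul_one, mul_zero]
  rw [muk, ← Finset.sum_filter, ← Finset.sum_filter]
  symm
  refine Finset.sum_nbij partialGraph ?_ ?_ ?_ fun _ _ => rfl
  · intro g hg
    refine mem_filter.2 ⟨(mem_filter.1 hg).2, card_image_of_injOn ?_⟩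
    rintro ⟨x, i⟩ h ⟨y, j⟩ h' heq
    simp only [partialGraph, coe_filter, mem_univ, true_and, Set.mem_ofPred_eq] at h h' heq
    subst heq
    simp_all
  · intro g _ g' _ h
    funext x
    have hx : ∀ i, g x = some i ↔ g' x = some i := fun i => by
      simpa [partialGraph] using Finset.ext_iff.1 h (x, i)
    exact Option.ext hx
  · intro S hS
    obtain ⟨hSF, hinj⟩ := mem_filter.1 (mem_coe.1 hS)
    have hinj' := card_image_iff.1 hinj
    let g : α → Option (Fin k) := fun x =>
      if h : ∃ i, (x, i) ∈ S then some h.choose else none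
    have hg : partialGraph g = S := by
      ext ⟨x, i⟩
      simp only [partialGraph, mem_filter, mem_univ, true_and, g]
      constructor
      · intro h
        split_ifs at h with hx
        have := hx.choose_spec
        rwa [Option.some.inj h] at this
      · intro h
        have hx : ∃ i, (x, i) ∈ S := ⟨i, h⟩
        rw [dif_pos hx]
        have := hinj' (mem_coe.2 hx.choose_spec) (mem_coe.2 h) rfl
        exact congrArg some (Prod.ext_iff.1 this).2
    refine ⟨g, ?_, hg⟩
    simp [hg, hSF]

lemma setExp_coloredPoly_subset {α : Type*} [Fintype α] [DecidableEq α] {k : ℕ} (hk : k ≠ 0)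
    (p : ℝ) (T : Finset α) :
    setExp (fun S => if T ⊆ S.image Prod.fst then 1 else 0) (coloredPoly α k p) =
      p ^ T.card := by
  rw [← setExp_bernoulliPoly_subset p T, ← setExp_rename Prod.fst
    (fun S => if T ⊆ S then (1 : ℝ) else 0), coloredPoly, bernoulliPoly, map_prod]
  congr 1
  refine Finset.prod_congr rfl fun x _ => ?_
  have hkr : (k : ℝ) ≠ 0 := by exact_mod_cast hk
  simp only [map_add, map_mul, map_sum, MvPolynomial.rename_C, MvPolynomial.rename_X,
    Finset.sum_const, card_univ, Fintype.card_fin, nsmul_eq_mul]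
  rw [← mul_assoc, ← map_natCast (MvPolynomial.C : ℝ →+* MvPolynomial α ℝ) k, ← map_mul,
    div_mul_cancel₀ _ hkr]

/-- If the sets in `H` have size less than `2 ^ m` and every cover of `H` has cost at least `κ`
at `p`, then every fractional cover of `H` has cost at least `κ - 1/15` at `64 m p`. -/
lemma sub_le_fractional_cost {α ι : Type*} [Fintype α] [DecidableEq α] {p P : ℝ} (hp : 0 ≤ p)
    (hp1 : 64 * p ≤ 1) (m : ℕ) (hP : P = m * (64 * p)) (hP1 : P ≤ 1) (H : Finset (Finset α))
    (hH : ∀ S ∈ H, S.card < 2 ^ m) (κ : ℝ)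
    (hκ : ∀ G : Finset (Finset α), (∀ S ∈ H, ∃ T ∈ G, T ⊆ S) → κ ≤ ∑ T ∈ G, p ^ T.card)
    (I : Finset ι) (w : ι → ℝ) (hw : ∀ i ∈ I, 0 ≤ w i) (T : ι → Finset α)
    (hT : ∀ S ∈ H, 1 ≤ ∑ i ∈ I.filter (fun i => T i ⊆ S), w i) :
    κ - 1 / 15 ≤ ∑ i ∈ I, w i * P ^ (T i).card := by
  have hP0 : 0 ≤ P := hP ▸ by positivity
  have h1 := sub_le_setExp_upIndicator hp rfl hp1 m H hH κ hκ
  have h2 := setExp_bernoulliPoly_pow_le (id : α → α) m (by positivity) hp1 hP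
    (fun x => by simpa [Finset.filter_eq'] using hP1)
    (upIndicator_mem_fiberSubmodular (H := H) fun T _ => Set.injOn_id _)
  have h3 : (∏ x : α, (MvPolynomial.C (1 - ((univ.filter fun e => id e = x).card : ℝ) * P) +
        MvPolynomial.C P * ∑ e ∈ univ.filter (fun e => id e = x), MvPolynomial.X e)) =
        bernoulliPoly α P := by
    refine Finset.prod_congr rfl fun x _ => ?_
    simp [Finset.filter_eq']
  rw [h3] at h2
  have h4 : setExp (upIndicator H) (bernoulliPoly α P) ≤
      setExp (fun S => ∑ i ∈ I, w i * if T i ⊆ S then 1 else 0) (bernoulliPoly α P) := by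
    refine setExp_mono (bernoulliPoly_mem hP0 hP1) fun S => ?_
    have hnn : ∀ i ∈ I, 0 ≤ w i * if T i ⊆ S then 1 else 0 := fun i hi =>
      mul_nonneg (hw i hi) (by split_ifs <;> norm_num)
    unfold upIndicator
    split_ifs with h
    · obtain ⟨S', hS', hS'S⟩ := h
      refine (hT S' hS').trans ?_
      rw [Finset.sum_filter]
      refine Finset.sum_le_sum fun i hi => ?_
      by_cases hi' : T i ⊆ S'
      · rw [if_pos hi', if_pos (hi'.trans hS'S), mul_one]
      · rw [if_neg hi']
        exact hnn i hi
    · exact Finset.sum_nonneg hnn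
  rw [setExp_sum_left] at h4
  simp only [setExp_const_mul_left, setExp_bernoulliPoly_subset] at h4
  have h5 : (0 : ℝ) ≤ (1 / 16) ^ m := by positivity
  linarith

lemma pow_le_three_pow_mul_descFactorial (k s : ℕ) (h : s ≤ k) :
    (k : ℝ) ^ s ≤ 3 ^ s * (k.descFactorial s : ℝ) := by
  induction k generalizing s with
  | zero => simp [Nat.le_zero.1 h]
  | succ k ih =>
    cases s with
    | zero => simp
    | succ s =>
      have hs : s ≤ k := Nat.succ_le_succ_iff.1 h
      have h1 := ih s hs
      have h2 : ((k + 1 : ℕ) : ℝ) ^ s ≤ 3 * (k : ℝ) ^ s := by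
        rcases k.eq_zero_or_pos with rfl | hk
        · simp [Nat.le_zero.1 hs]
        · have hk' : (0 : ℝ) < k := by exact_mod_cast hk
          have h3 : ((k + 1 : ℕ) : ℝ) = k * (1 + 1 / k) := by
            push_cast
            field_simp
          have h4 : (1 + 1 / (k : ℝ)) ^ s ≤ 3 := by
            calc (1 + 1 / (k : ℝ)) ^ s ≤ (1 + 1 / (k : ℝ)) ^ k :=
                  pow_le_pow_right₀ (by linarith [one_div_pos.2 hk']) hs
              _ ≤ (Real.exp (1 / k)) ^ k :=
                  pow_le_pow_left₀ (by positivity)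
                    (by linarith [Real.add_one_le_exp (1 / (k : ℝ))]) _
              _ = Real.exp 1 := by
                  rw [← Real.exp_nat_mul, mul_one_div_cancel hk'.ne']
              _ ≤ 3 := by linarith [Real.exp_one_lt_d9]
          rw [h3, mul_pow, mul_comm]
          exact mul_le_mul_of_nonneg_right h4 (by positivity)
      rw [Nat.succ_descFactorial_succ, pow_succ, pow_succ]
      push_cast at h2 ⊢
      have h5 : (0 : ℝ) ≤ k + 1 := by positivity
      calc ((k : ℝ) + 1) ^ s * (k + 1) ≤ 3 * (k : ℝ) ^ s * (k + 1) :=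
            mul_le_mul_of_nonneg_right h2 h5
        _ ≤ 3 * (3 ^ s * (k.descFactorial s : ℝ)) * (k + 1) := by gcongr
        _ = _ := by ring

/-- The number of injections extending a partial function `S`. -/
lemma card_embedding_extending_le {α : Type*} [DecidableEq α] {k : ℕ} (e : Finset α)
    (S : Finset (α × Fin k)) :
    (univ.filter fun φ : e ↪ Fin k => ∀ y ∈ S, ∃ h : y.1 ∈ e, φ ⟨y.1, h⟩ = y.2).card ≤
      (k - S.card).descFactorial (e.card - S.card) := by
  rcases (univ.filter fun φ : e ↪ Fin k =>
    ∀ y ∈ S, ∃ h : y.1 ∈ e, φ ⟨y.1, h⟩ = y.2).eq_empty_or_nonempty with h0 | ⟨φ₀, hφ₀⟩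
  · rw [h0]
    simp
  have hext := (mem_filter.1 hφ₀).2
  have hfst : Set.InjOn Prod.fst (S : Set (α × Fin k)) := by
    rintro ⟨x, i⟩ h ⟨y, j⟩ h' heq
    obtain ⟨_, h1⟩ := hext _ h
    obtain ⟨_, h2⟩ := hext _ h'
    simp only at heq h1 h2
    subst heq
    rw [← h1, ← h2]
  have hsnd : Set.InjOn Prod.snd (S : Set (α × Fin k)) := by
    rintro ⟨x, i⟩ h ⟨y, j⟩ h' heq
    obtain ⟨_, h1⟩ := hext _ h
    obtain ⟨_, h2⟩ := hext _ h'
    simp only at heq h1 h2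
    subst heq
    have := φ₀.injective (h1.trans h2.symm)
    simpa using this
  have hsub : S.image Prod.fst ⊆ e := fun x hx => by
    obtain ⟨y, hy, rfl⟩ := mem_image.1 hx
    exact (hext y hy).1
  set A := e \ S.image Prod.fst
  set B := (univ : Finset (Fin k)) \ S.image Prod.snd
  have hA : A.card = e.card - S.card := by
    rw [card_sdiff_of_subset hsub, card_image_of_injOn hfst]
  have hB : B.card = k - S.card := by
    rw [card_sdiff_of_subset (subset_univ _), card_image_of_injOn hsnd, card_univ,
      Fintype.card_fin]
  have hcard : Fintype.card (A ↪ B) = (k - S.card).descFactorial (e.card - S.card) := by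
    rw [Fintype.card_embedding_eq, Fintype.card_coe, Fintype.card_coe, hA, hB]
  rw [← hcard, ← Fintype.card_coe]
  let res : {φ // φ ∈ univ.filter fun φ : e ↪ Fin k =>
      ∀ y ∈ S, ∃ h : y.1 ∈ e, φ ⟨y.1, h⟩ = y.2} → (A ↪ B) := fun φ =>
    { toFun := fun x => ⟨φ.1 ⟨x.1, (mem_sdiff.1 x.2).1⟩, by
        refine mem_sdiff.2 ⟨mem_univ _, fun hmem => ?_⟩
        obtain ⟨y, hy, hyx⟩ := mem_image.1 hmem
        obtain ⟨hye, hφy⟩ := (mem_filter.1 φ.2).2 y hy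
        have := φ.1.injective (hφy.trans hyx)
        refine (mem_sdiff.1 x.2).2 (mem_image.2 ⟨y, hy, ?_⟩)
        simpa using this⟩
      inj' := fun x x' h => by
        have := φ.1.injective (Subtype.ext_iff.1 h)
        exact Subtype.ext (by simpa using this) }
  refine Fintype.card_le_of_injective res fun φ φ' h => ?_
  ext x
  by_cases hx : x.1 ∈ S.image Prod.fst
  · obtain ⟨y, hy, hyx⟩ := mem_image.1 hx
    obtain ⟨h1, h2⟩ := (mem_filter.1 φ.2).2 y hy
    obtain ⟨h1', h2'⟩ := (mem_filter.1 φ'.2).2 y hy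
    have hxy : x = ⟨y.1, h1⟩ := Subtype.ext hyx.symm
    rw [hxy, h2, h2']
  · have := DFunLike.congr_fun h ⟨x.1, mem_sdiff.2 ⟨x.2, hx⟩⟩
    exact congrArg Fin.val (Subtype.ext_iff.1 this)

/-- A family containing a subset of the graph of every injection `e → Fin k` is a fractional cover
with weights `(3 / k) ^ s`. -/
lemma one_le_sum_three_div_pow {α : Type*} [DecidableEq α] {k : ℕ} (hk : k ≠ 0) (e : Finset α)
    (he : e.card ≤ k) (G : Finset (Finset (α × Fin k)))
    (hG : ∀ φ : e ↪ Fin k, ∃ S ∈ G, ∀ y ∈ S, ∃ h : y.1 ∈ e, φ ⟨y.1, h⟩ = y.2) :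
    1 ≤ ∑ S ∈ (G.filter fun S => (S.image Prod.fst).card = S.card).filter
      (fun S => S.image Prod.fst ⊆ e), (3 / (k : ℝ)) ^ S.card := by
  set G' := (G.filter fun S => (S.image Prod.fst).card = S.card).filter
      (fun S => S.image Prod.fst ⊆ e) with hG'
  have hG2 : ∀ φ : e ↪ Fin k, ∃ S ∈ G', ∀ y ∈ S, ∃ h : y.1 ∈ e, φ ⟨y.1, h⟩ = y.2 := by
    intro φ
    obtain ⟨S, hS, hφ⟩ := hG φ
    refine ⟨S, mem_filter.2 ⟨mem_filter.2 ⟨hS, card_image_of_injOn ?_⟩, fun x hx => ?_⟩, hφ⟩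
    · rintro ⟨x, i⟩ h ⟨y, j⟩ h' heq
      obtain ⟨_, h1⟩ := hφ _ h
      obtain ⟨_, h2⟩ := hφ _ h'
      simp only at heq h1 h2
      subst heq
      rw [← h1, ← h2]
    · obtain ⟨y, hy, rfl⟩ := mem_image.1 hx
      exact (hφ y hy).1
  have hcount : k.descFactorial e.card ≤
      ∑ S ∈ G', (k - S.card).descFactorial (e.card - S.card) := by
    have h1 : k.descFactorial e.card = (univ : Finset (e ↪ Fin k)).card := by
      rw [card_univ, Fintype.card_embedding_eq, Fintype.card_fin, Fintype.card_coe]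
    rw [h1]
    have h2 : (univ : Finset (e ↪ Fin k)) ⊆ G'.biUnion fun S =>
        univ.filter fun φ : e ↪ Fin k => ∀ y ∈ S, ∃ h : y.1 ∈ e, φ ⟨y.1, h⟩ = y.2 := by
      intro φ _
      obtain ⟨S, hS, hφ⟩ := hG2 φ
      exact mem_biUnion.2 ⟨S, hS, mem_filter.2 ⟨mem_univ _, hφ⟩⟩
    exact (card_le_card h2).trans (card_biUnion_le.trans
      (Finset.sum_le_sum fun S _ => card_embedding_extending_le e S))
  have hpos : (0 : ℝ) < k.descFactorial e.card := by
    exact_mod_cast Nat.descFactorial_pos.2 he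
  have hk' : (0 : ℝ) < k := by exact_mod_cast Nat.pos_of_ne_zero hk
  refine le_of_mul_le_mul_left ?_ hpos
  rw [mul_one, Finset.mul_sum]
  calc (k.descFactorial e.card : ℝ)
      ≤ ∑ S ∈ G', ((k - S.card).descFactorial (e.card - S.card) : ℝ) := by exact_mod_cast hcount
    _ ≤ _ := Finset.sum_le_sum fun S hS => ?_
  obtain ⟨hS1, hSe⟩ := mem_filter.1 hS
  have hSc : S.card ≤ e.card := by
    rw [← (mem_filter.1 hS1).2]
    exact card_le_card hSe
  rw [← Nat.descFactorial_mul_descFactorial hSc]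
  push_cast
  rw [mul_assoc]
  refine le_mul_of_one_le_right (by positivity) ?_
  rw [div_pow, ← mul_div_assoc, one_le_div (by positivity), mul_comm]
  exact pow_le_three_pow_mul_descFactorial k S.card (hSc.trans he)

/-- The rainbow edges of the hypergraph `H` with colors in `Fin k`. -/
noncomputable def rainbowEdges {α : Type*} [Fintype α] [DecidableEq α] (H : Finset (Finset α))
    (k : ℕ) : Finset (Finset (α × Fin k)) :=
  univ.filter fun S => (S.image Prod.fst).card = S.card ∧
    (S.image Prod.snd).card = S.card ∧ S.image Prod.fst ∈ H

lemma exists_subset_graph {α : Type*} [Fintype α] [DecidableEq α] {H : Finset (Finset α)} {k : ℕ}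
    {G : Finset (Finset (α × Fin k))} (hG : ∀ S ∈ rainbowEdges H k, ∃ T ∈ G, T ⊆ S)
    {e : Finset α} (he : e ∈ H) (φ : e ↪ Fin k) :
    ∃ S ∈ G, ∀ y ∈ S, ∃ h : y.1 ∈ e, φ ⟨y.1, h⟩ = y.2 := by
  set S : Finset (α × Fin k) := univ.image fun x : e => (x.1, φ x) with hS
  have hfst : S.image Prod.fst = e := by
    ext x
    simp [hS]
  have hcard : S.card = e.card := by
    rw [hS, card_image_of_injective _ fun x y h => Subtype.ext (Prod.ext_iff.1 h).1, card_univ,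
      Fintype.card_coe]
  have hsnd : (S.image Prod.snd).card = S.card := by
    refine card_image_of_injOn fun y hy y' hy' h => ?_
    obtain ⟨x, -, rfl⟩ := mem_image.1 (mem_coe.1 hy)
    obtain ⟨x', -, rfl⟩ := mem_image.1 (mem_coe.1 hy')
    rw [φ.injective h]
  obtain ⟨T, hT, hTS⟩ := hG S (mem_filter.2 ⟨mem_univ _, by rw [hfst, hcard], hsnd, by rwa [hfst]⟩)
  refine ⟨T, hT, fun y hy => ?_⟩
  obtain ⟨x, -, rfl⟩ := mem_image.1 (hTS hy)
  exact ⟨x.2, rfl⟩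

lemma mem_rainbowFamily {α : Type*} [Fintype α] [DecidableEq α] {F : Finset (Finset α)} {k : ℕ}
    {T : Finset (α × Fin k)} :
    T ∈ rainbowFamily F k ↔ ∃ S ∈ rainbowEdges (minimals F) k, S ⊆ T := by
  simp only [rainbowFamily, rainbowEdges, mem_filter, mem_univ, true_and]
  constructor
  · rintro ⟨S, hsub, hedge⟩
    exact ⟨S, hedge, hsub⟩
  · rintro ⟨S, hedge, hsub⟩
    exact ⟨S, hsub, hedge⟩

/-- If every cover of `minimals F` has cost at least `1` at `p`, then `F^rb` is likely at
`12288 * m ^ 2 * p`. -/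
lemma half_lt_muk {α : Type*} [Fintype α] [DecidableEq α] {F : Finset (Finset α)} {k m : ℕ}
    (hm : 1 ≤ m) (hell : ell F < 2 ^ m) (hk : k ≠ 0) (hellk : ell F ≤ k) {p P : ℝ} (hp : 0 ≤ p)
    (hκ : ∀ G : Finset (Finset α), (∀ S ∈ minimals F, ∃ T ∈ G, T ⊆ S) →
      1 ≤ ∑ T ∈ G, p ^ T.card)
    (hP : P = 12288 * m ^ 2 * p) (hP1 : P ≤ 1) : 1 / 2 < muk P k (rainbowFamily F k) := by
  have hk0 : (0 : ℝ) < k := by exact_mod_cast Nat.pos_of_ne_zero hk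
  have hk1 : (1 : ℝ) ≤ k := by exact_mod_cast Nat.one_le_iff_ne_zero.2 hk
  have hm1 : (1 : ℝ) ≤ m := by exact_mod_cast hm
  have hP0 : 0 ≤ P := hP ▸ by positivity
  set H := minimals F with hH
  have hcard : ∀ S ∈ H, S.card ≤ ell F := fun S hS => Finset.le_sup (f := Finset.card) hS
  set p₁ : ℝ := m * (64 * p) with hp₁
  have hp₁0 : 0 ≤ p₁ := by positivity
  have hPp₁ : P = m * (64 * (3 * p₁)) := by rw [hP, hp₁]; ring
  have hp₁1 : 64 * (3 * p₁) ≤ 1 := by nlinarith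
  have hp64 : 64 * p ≤ p₁ := by nlinarith
  set H' := rainbowEdges H k with hH'
  have hcard' : ∀ S ∈ H', S.card < 2 ^ m := fun S hS => by
    obtain ⟨-, h1, -, h2⟩ := mem_filter.1 hS
    rw [← h1]
    exact (hcard _ h2).trans_lt hell
  set r : ℝ := 64 * (3 * p₁ / k) with hr
  have hr0 : 0 ≤ r := by positivity
  have hr1 : r ≤ 1 := by
    rw [hr, ← mul_div_assoc, div_le_one hk0]
    exact hp₁1.trans hk1
  have hcover : ∀ G : Finset (Finset (α × Fin k)), (∀ S ∈ H', ∃ T ∈ G, T ⊆ S) →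
      14 / 15 ≤ ∑ T ∈ G, (3 * p₁ / k) ^ T.card := by
    intro G hG
    have h := sub_le_fractional_cost hp (by linarith) m hp₁ (by linarith) H
      (fun S hS => (hcard S hS).trans_lt hell) 1 hκ
      (G.filter fun S => (S.image Prod.fst).card = S.card) (fun S => (3 / (k : ℝ)) ^ S.card)
      (fun S _ => by positivity) (fun S => S.image Prod.fst)
      (fun e he => one_le_sum_three_div_pow hk e ((hcard e he).trans hellk) G
        (exists_subset_graph hG he))
    calc (14 / 15 : ℝ) = 1 - 1 / 15 := by norm_num
      _ ≤ _ := h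
      _ = ∑ S ∈ G.filter fun S => (S.image Prod.fst).card = S.card, (3 * p₁ / k) ^ S.card := by
        refine Finset.sum_congr rfl fun S hS => ?_
        rw [(mem_filter.1 hS).2, ← mul_pow]
        congr 1
        ring
      _ ≤ _ := Finset.sum_le_sum_of_subset_of_nonneg (filter_subset _ _)
        fun S _ _ => by positivity
  have h1 := sub_le_setExp_upIndicator (by positivity) hr hr1 m H' hcard' _ hcover
  have hfib : ∀ x : α, (univ.filter fun e : α × Fin k => e.1 = x) =
      univ.image fun i : Fin k => (x, i) := by
    intro x
    ext ⟨y, i⟩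
    simp [eq_comm]
  have hinj : ∀ x : α, Function.Injective fun i : Fin k => (x, i) := fun x i j h =>
    (Prod.ext_iff.1 h).2
  have hfibcard : ∀ x : α, (univ.filter fun e : α × Fin k => e.1 = x).card = k := fun x => by
    rw [hfib, card_image_of_injective _ (hinj x), card_univ, Fintype.card_fin]
  have h2 := setExp_bernoulliPoly_pow_le (Prod.fst : α × Fin k → α) (P := P / k) m hr0 hr1
    (by rw [hPp₁, hr]; ring)
    (fun x => by rw [hfibcard, mul_div_cancel₀ _ hk0.ne']; exact hP1)
    (upIndicator_mem_fiberSubmodular (H := H') fun T hT =>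
      card_image_iff.1 (mem_filter.1 hT).2.1)
  have h3 : (∏ x : α, (MvPolynomial.C (1 -
        ((univ.filter fun e : α × Fin k => e.1 = x).card : ℝ) * (P / k)) +
        MvPolynomial.C (P / k) * ∑ e ∈ univ.filter (fun e : α × Fin k => e.1 = x),
          MvPolynomial.X e)) = coloredPoly α k P := by
    refine Finset.prod_congr rfl fun x _ => ?_
    rw [hfibcard, mul_div_cancel₀ _ hk0.ne', hfib, Finset.sum_image fun i _ j _ h => hinj x h]
  rw [h3] at h2
  have h4 : muk P k (rainbowFamily F k) = setExp (upIndicator H') (coloredPoly α k P) := by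
    rw [muk_eq_setExp]
    congr 2
    funext S
    by_cases hS : S ∈ rainbowFamily F k
    · rw [upIndicator, if_pos hS, if_pos (mem_rainbowFamily.1 hS)]
    · rw [upIndicator, if_neg hS, if_neg fun h => hS (mem_rainbowFamily.2 h)]
  rw [h4]
  have h5 : (0 : ℝ) ≤ (1 / 16) ^ m := by positivity
  linarith

lemma lt_one_of_pSmall {α : Type*} [Fintype α] [DecidableEq α] {F : Finset (Finset α)}
    (hF : F.Nonempty) {p : ℝ} (h : PSmall p F) : p < 1 := by
  by_contra! hp
  obtain ⟨G, hG, hsum⟩ := h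
  obtain ⟨A, hA⟩ := hF
  obtain ⟨S, hS, -⟩ := hG A hA
  have h1 := Finset.single_le_sum (f := fun S : Finset α => p ^ S.card)
    (fun S _ => by positivity) hS
  have h2 : 1 ≤ p ^ S.card := one_le_pow₀ hp
  linarith

lemma bddAbove_pSmall {α : Type*} [Fintype α] [DecidableEq α] {F : Finset (Finset α)}
    (hF : F.Nonempty) : BddAbove {p : ℝ | PSmall p F} :=
  ⟨1, fun _ hp => (lt_one_of_pSmall hF hp).le⟩

lemma pSmall_zero {α : Type*} [Fintype α] [DecidableEq α] {F : Finset (Finset α)}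
    (hF : ∅ ∉ F) : PSmall 0 F := by
  refine ⟨F, fun T hT => ⟨T, hT, subset_rfl⟩, ?_⟩
  rw [Finset.sum_eq_zero]
  · norm_num
  · intro S hS
    exact zero_pow (card_ne_zero.2 (nonempty_iff_ne_empty.2 fun h => hF (h ▸ hS)))

lemma one_le_cost_of_not_pSmall {α : Type*} [Fintype α] [DecidableEq α] {F : Finset (Finset α)}
    {p : ℝ} (hp : 0 ≤ p) (h : ¬ PSmall p F) (G : Finset (Finset α))
    (hG : ∀ S ∈ minimals F, ∃ T ∈ G, T ⊆ S) : 1 ≤ ∑ T ∈ G, (2 * p) ^ T.card := by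
  by_cases h0 : ∅ ∈ G
  · have := Finset.single_le_sum (f := fun S : Finset α => (2 * p) ^ S.card)
      (fun S _ => by positivity) h0
    simpa using this
  · have h1 : 1 / 2 < ∑ T ∈ G, p ^ T.card := by
      by_contra! hle
      refine h ⟨G, fun A hA => ?_, hle⟩
      obtain ⟨B, hB, hBA⟩ := exists_minimals_subset hA
      obtain ⟨T, hT, hTB⟩ := hG B hB
      exact ⟨T, hT, hTB.trans hBA⟩
    have h2 : 2 * ∑ T ∈ G, p ^ T.card ≤ ∑ T ∈ G, (2 * p) ^ T.card := by
      rw [Finset.mul_sum]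
      refine Finset.sum_le_sum fun T hT => ?_
      rw [mul_pow]
      refine mul_le_mul_of_nonneg_right ?_ (by positivity)
      exact le_self_pow₀ (by norm_num)
        (card_ne_zero.2 (nonempty_iff_ne_empty.2 fun h => h0 (h ▸ hT)))
    linarith

lemma muk_rainbowFamily_le {α : Type*} [Fintype α] [DecidableEq α] {F : Finset (Finset α)} {k : ℕ}
    (hk : k ≠ 0) {p : ℝ} (hp : 0 ≤ p) (hp1 : p ≤ 1) {G : Finset (Finset α)}
    (hG : ∀ T ∈ F, ∃ S ∈ G, S ⊆ T) :
    muk p k (rainbowFamily F k) ≤ ∑ S ∈ G, p ^ S.card := by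
  rw [muk_eq_setExp, ← Finset.sum_congr rfl fun S _ => setExp_coloredPoly_subset hk p S,
    ← setExp_sum_left]
  refine setExp_mono (coloredPoly_mem k hp hp1) fun T => ?_
  have hnn : ∀ S ∈ G, (0 : ℝ) ≤ if S ⊆ T.image Prod.fst then 1 else 0 := fun S _ => by
    split_ifs <;> norm_num
  split_ifs with h
  · obtain ⟨R, hR, hRT⟩ := mem_rainbowFamily.1 h
    obtain ⟨S, hS, hSR⟩ := hG _ (mem_minimals.1 (mem_filter.1 hR).2.2.2).1
    refine le_trans ?_ (Finset.single_le_sum hnn hS)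
    rw [if_pos (hSR.trans (image_subset_image hRT))]
  · exact Finset.sum_nonneg hnn

/-- There is an absolute constant `K'' > 0` such that for every finite `X`, every nontrivial
increasing family `F ⊆ 2^X` with `ℓ(F) ≥ 2`, every `k ≥ ℓ(F)`, and the `k`-color rainbow
threshold `p_c^k(F)` (the unique `p ∈ (0,1)` with `μ_p^k(F^rb) = 1/2`), one has
`q(F) ≤ p_c^k(F) ≤ K'' q(F) (log ℓ(F))²`. -/
theorem rainbow_threshold_expectation :
    ∃ K'' : ℝ, 0 < K'' ∧
      ∀ (α : Type) [Fintype α] [DecidableEq α], ∀ F : Finset (Finset α),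
        Increasing F → F.Nonempty → F ≠ Finset.univ → 2 ≤ ell F →
        ∀ k : ℕ, ell F ≤ k →
        ∀ pck : ℝ, 0 < pck → pck < 1 → muk pck k (rainbowFamily F k) = 1 / 2 →
          qexp F ≤ pck ∧ pck ≤ K'' * qexp F * Real.log (ell F) ^ 2 := by
  refine ⟨24576 * 9, by norm_num, ?_⟩
  intro α _ _ F hinc hne huniv hell k hk p hp hp1 hmuk
  have hk0 : k ≠ 0 := by omega
  have hempty : ∅ ∉ F := fun h =>
    huniv (Finset.eq_univ_of_forall fun S => hinc ∅ h S (empty_subset S))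
  have hq0 : 0 ≤ qexp F := le_csSup (bddAbove_pSmall hne) (pSmall_zero hempty)
  constructor
  · refine csSup_le ⟨0, pSmall_zero hempty⟩ fun p' hp' => ?_
    by_contra! hlt
    obtain ⟨G, hG, hsum⟩ := hp'
    have hGne : G.Nonempty := by
      obtain ⟨A, hA⟩ := hne
      obtain ⟨S, hS, -⟩ := hG A hA
      exact ⟨S, hS⟩
    have h0 : ∅ ∉ G := fun h => by
      have := Finset.single_le_sum (f := fun S : Finset α => p' ^ S.card)
        (fun S _ => pow_nonneg (hp.trans hlt).le _) h
      simp only [card_empty, pow_zero] at this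
      linarith
    have h1 : ∑ S ∈ G, p ^ S.card < ∑ S ∈ G, p' ^ S.card :=
      Finset.sum_lt_sum_of_nonempty hGne fun S hS => pow_lt_pow_left₀ hlt hp.le
        (card_ne_zero.2 (nonempty_iff_ne_empty.2 fun h => h0 (h ▸ hS)))
    linarith [muk_rainbowFamily_le hk0 hp.le hp1.le hG]
  · set m := Nat.log 2 (ell F) + 1 with hm
    have hellm : ell F < 2 ^ m := Nat.lt_pow_succ_log_self (by norm_num) _
    have hm0 : (0 : ℝ) < m := by positivity
    have hlog : (m : ℝ) ≤ 3 * Real.log (ell F) := by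
      have h1 : 1 ≤ Nat.log 2 (ell F) := Nat.log_pos (by norm_num) hell
      have h2 : 2 ^ Nat.log 2 (ell F) ≤ ell F := Nat.pow_log_le_self 2 (by omega)
      have h3 : Real.log ((2 : ℝ) ^ Nat.log 2 (ell F)) ≤ Real.log (ell F) :=
        Real.log_le_log (by positivity) (by exact_mod_cast h2)
      rw [Real.log_pow] at h3
      have h4 : (1 : ℝ) ≤ (Nat.log 2 (ell F) : ℕ) := by exact_mod_cast h1
      rw [hm]
      push_cast
      nlinarith [Real.log_two_gt_d9]
    have hmain : p / (24576 * m ^ 2) ≤ qexp F := by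
      by_contra! hlt
      have hns : ¬ PSmall (p / (24576 * m ^ 2)) F := fun h =>
        hlt.not_ge (le_csSup (bddAbove_pSmall hne) h)
      have := half_lt_muk (F := F) (k := k) (m := m) (p := 2 * (p / (24576 * m ^ 2))) (P := p)
        (by omega) hellm hk0 hk (by positivity)
        (one_le_cost_of_not_pSmall (by positivity) hns) (by field_simp; norm_num) hp1.le
      linarith
    rw [div_le_iff₀ (by positivity)] at hmain
    have hsq : (m : ℝ) ^ 2 ≤ 9 * Real.log (ell F) ^ 2 := by
      calc (m : ℝ) ^ 2 ≤ (3 * Real.log (ell F)) ^ 2 := pow_le_pow_left₀ hm0.le hlog 2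
        _ = _ := by ring
    calc p ≤ qexp F * (24576 * m ^ 2) := hmain
      _ ≤ qexp F * (24576 * (9 * Real.log (ell F) ^ 2)) := by gcongr
      _ = _ := by ring
end

section
/- There exist an absolute constant C > 0 and a function ε : ℕ → [0,1] with ε(r) → 0 as r → ∞ such that the following holds. Let H be an r-bounded κ-spread multi-hypergraph with r ≥ 2, let X = V(H), let k ≥ r be an integer, and let each element of X be colored independently and uniformly at random from [k]. If C log r / κ ≤ p ≤ 1, then with probability at least 1 − ε(r), the random subset X_p contains a rainbow edge of H, i.e. an edge of H all of whose elements receive pairwise distinct colors. -/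
open Finset
open scoped Classical

/-- A multi-hypergraph `H` (a multiset of edges) is `κ`-spread: for every `S ⊆ X`,
the number of edges of `H` containing `S` (with multiplicity) is at most `κ^{-|S|}|H|`. -/
def Spread {α : Type*} [DecidableEq α] (κ : ℝ) (H : Multiset (Finset α)) : Prop :=
  ∀ S : Finset α, ((H.filter fun E => S ⊆ E).card : ℝ) ≤ κ⁻¹ ^ S.card * (H.card : ℝ)

/-- The probability that, when each element of `X` is colored independently and uniformly
at random from `[k]` and each element of `X` is kept independently with probability `p`,
the random subset `X_p` contains a rainbow edge of `H` (an edge all of whose elements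
receive pairwise distinct colors). -/
noncomputable def rainbowProb {α : Type*} [Fintype α] [DecidableEq α] (k : ℕ) (p : ℝ)
    (H : Multiset (Finset α)) : ℝ :=
  ∑ c : α → Fin k, ∑ W : Finset α,
    ((k : ℝ) ^ Fintype.card α)⁻¹ * p ^ W.card * (1 - p) ^ (Fintype.card α - W.card) *
      (if ∃ E ∈ H, E ⊆ W ∧ Set.InjOn c ↑E then 1 else 0)

/-- The `p`-biased weight of a subset `W` of a finite type. -/
noncomputable def biasedWeight {Y : Type*} [Fintype Y] (p : ℝ) (W : Finset Y) : ℝ :=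
  p ^ #W * (1 - p) ^ (Fintype.card Y - #W)

/-- The probability that a `p`-random subset contains no member of `F`. -/
noncomputable def missProb {Y : Type*} [Fintype Y] (p : ℝ) (F : Finset (Finset Y)) : ℝ :=
  ∑ W : Finset Y, biasedWeight p W * (if ∃ E ∈ F, E ⊆ W then 0 else 1)

/-- The proportion of indices `i` for which `h i` contains a member of `F`. -/
noncomputable def coverRatio {Y ι : Type*} [Fintype ι] (h : ι → Finset Y)
    (F : Finset (Finset Y)) : ℝ :=
  (#{i | ∃ T ∈ F, T ⊆ h i} : ℝ) / Fintype.card ι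

/-- The inclusion-minimal sets among the traces `E \ W` of the edges `E` of `F`. -/
noncomputable def minimalFragments {Y : Type*} (F : Finset (Finset Y)) (W : Finset Y) :
    Finset (Finset Y) :=
  {T ∈ F.image (· \ W) | ∀ E ∈ F, E \ W ⊆ T → E \ W = T}

lemma mem_minimalFragments {Y : Type*} {F : Finset (Finset Y)} {W T : Finset Y} :
    T ∈ minimalFragments F W ↔
      (∃ E ∈ F, E \ W = T) ∧ ∀ E ∈ F, E \ W ⊆ T → E \ W = T := by
  simp [minimalFragments]

lemma exists_minimalFragments_subset {Y : Type*} {F : Finset (Finset Y)} (W : Finset Y)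
    {E : Finset Y} (hE : E ∈ F) : ∃ T ∈ minimalFragments F W, T ⊆ E := by
  obtain ⟨T, hTE, hT⟩ := (F.image (· \ W)).exists_le_minimal (mem_image_of_mem (· \ W) hE)
  refine ⟨T, mem_minimalFragments.2 ⟨by simpa using hT.prop, fun E' hE' h => ?_⟩,
    hTE.trans sdiff_subset⟩
  exact h.antisymm (hT.le_of_le (mem_image_of_mem (· \ W) hE') h)

lemma coverRatio_le_one {Y ι : Type*} [Fintype ι] (h : ι → Finset Y) (F : Finset (Finset Y)) : coverRatio h F ≤ 1 := by
  refine div_le_one_of_le₀ ?_ (by positivity)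
  exact_mod_cast card_le_univ _

lemma coverRatio_le_add {Y ι : Type*} [Fintype ι] {h : ι → Finset Y} {q : ℝ} (hq0 : 0 ≤ q)
    (hq : ∀ S : Finset Y, (#{i | S ⊆ h i} : ℝ) ≤ q ^ #S * Fintype.card ι)
    {F F' G : Finset (Finset Y)} (hcov : ∀ E ∈ F, ∃ T ∈ F' ∪ G, T ⊆ E) :
    coverRatio h F ≤ coverRatio h F' + ∑ T ∈ G, q ^ #T := by
  rcases isEmpty_or_nonempty ι with hι | hι
  · simpa [coverRatio] using Finset.sum_nonneg fun T _ => pow_nonneg hq0 _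
  have hpos : (0 : ℝ) < Fintype.card ι := by exact_mod_cast Fintype.card_pos
  rw [coverRatio, coverRatio, div_le_iff₀ hpos, add_mul, div_mul_cancel₀ _ hpos.ne',
    Finset.sum_mul]
  have hsub : (univ.filter fun i => ∃ T ∈ F, T ⊆ h i) ⊆
      (univ.filter fun i => ∃ T ∈ F', T ⊆ h i) ∪ G.biUnion fun T => {i | T ⊆ h i} := by
    intro i hi
    obtain ⟨E, hE, hEi⟩ := (mem_filter.1 hi).2
    obtain ⟨T, hT, hTE⟩ := hcov E hE
    rcases mem_union.1 hT with hT | hT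
    · exact mem_union_left _ (mem_filter.2 ⟨mem_univ _, T, hT, hTE.trans hEi⟩)
    · exact mem_union_right _ (mem_biUnion.2 ⟨T, hT, mem_filter.2 ⟨mem_univ _, hTE.trans hEi⟩⟩)
  have h1 := (card_le_card hsub).trans ((card_union_le _ _).trans
    (Nat.add_le_add_left card_biUnion_le _))
  calc (#{i | ∃ T ∈ F, T ⊆ h i} : ℝ)
      ≤ #{i | ∃ T ∈ F', T ⊆ h i} + ∑ T ∈ G, (#{i | T ⊆ h i} : ℝ) := by exact_mod_cast h1
    _ ≤ _ := by gcongr with T _; exact hq T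

section Biased

variable {Y : Type*} [Fintype Y]

lemma biasedWeight_nonneg {p : ℝ} (h0 : 0 ≤ p) (h1 : p ≤ 1) (W : Finset Y) :
    0 ≤ biasedWeight p W :=
  mul_nonneg (pow_nonneg h0 _) (pow_nonneg (sub_nonneg.2 h1) _)

lemma sum_biasedWeight (p : ℝ) : ∑ W : Finset Y, biasedWeight p W = 1 := by
  have := Finset.sum_pow_mul_eq_add_pow p (1 - p) (univ : Finset Y)
  simpa [biasedWeight] using this

/-- The union of independent `a`-random and `b`-random subsets is `(a + b - a * b)`-random. -/
lemma sum_biasedWeight_union (a b : ℝ) (g : Finset Y → ℝ) :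
    ∑ V : Finset Y, biasedWeight a V * ∑ W : Finset Y, biasedWeight b W * g (V ∪ W) =
      ∑ Z : Finset Y, biasedWeight (a + b - a * b) Z * g Z := by
  have key : ∀ Z : Finset Y, ∑ V : Finset Y, biasedWeight a V *
      ∑ W : Finset Y, (if V ∪ W = Z then biasedWeight b W else 0) =
        biasedWeight (a + b - a * b) Z := by
    intro Z
    have inner : ∀ V : Finset Y, V ⊆ Z →
        ∑ W : Finset Y, (if V ∪ W = Z then biasedWeight b W else 0) =
          b ^ (#Z - #V) * (1 - b) ^ (Fintype.card Y - #Z) := by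
      intro V hV
      rw [← Finset.sum_filter]
      have e : (univ.filter fun W : Finset Y => V ∪ W = Z) =
          V.powerset.image (fun U => U ∪ (Z \ V)) := by
        ext W
        simp only [mem_filter, mem_univ, true_and, mem_image, mem_powerset]
        constructor
        · intro h
          refine ⟨W ∩ V, inter_subset_right, ?_⟩
          subst h
          ext x
          simp
          tauto
        · rintro ⟨U, hU, rfl⟩
          ext x
          have := @hU x
          have := @hV x
          simp
          tauto
      rw [e, Finset.sum_image]
      · have hs := Finset.sum_pow_mul_eq_add_pow b (1 - b) V
        rw [add_sub_cancel, one_pow] at hs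
        trans b ^ (#Z - #V) * (1 - b) ^ (Fintype.card Y - #Z) *
          ∑ U ∈ V.powerset, b ^ #U * (1 - b) ^ (#V - #U)
        swap
        · rw [hs, mul_one]
        rw [Finset.mul_sum]
        refine Finset.sum_congr rfl fun U hU => ?_
        have hU := mem_powerset.1 hU
        have hd : Disjoint U (Z \ V) := (disjoint_sdiff).mono_left hU
        have c1 := card_le_card hU
        have c2 := card_le_card hV
        have c3 := card_le_univ Z
        rw [biasedWeight, card_union_of_disjoint hd, card_sdiff_of_subset hV,
          show Fintype.card Y - (#U + (#Z - #V)) = (Fintype.card Y - #Z) + (#V - #U) by omega]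
        ring
      · intro U hU U' hU' h
        have hU := mem_powerset.1 (mem_coe.1 hU)
        have hU' := mem_powerset.1 (mem_coe.1 hU')
        ext x
        have h := Finset.ext_iff.1 h x
        have := @hU x
        have := @hU' x
        simp at h
        tauto
    have outer : ∀ V : Finset Y, ¬ V ⊆ Z →
        ∑ W : Finset Y, (if V ∪ W = Z then biasedWeight b W else 0) = 0 := by
      intro V hV
      refine Finset.sum_eq_zero fun W _ => if_neg ?_
      rintro rfl
      exact hV subset_union_left
    rw [← Finset.sum_subset (subset_univ Z.powerset)
      (fun V _ hV => by rw [outer V (by simpa using hV), mul_zero])]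
    have hs := Finset.sum_pow_mul_eq_add_pow a ((1 - a) * b) Z
    rw [biasedWeight, show a + b - a * b = a + (1 - a) * b by ring, ← hs, Finset.sum_mul]
    refine Finset.sum_congr rfl fun V hV => ?_
    have hV := mem_powerset.1 hV
    have c2 := card_le_card hV
    have c3 := card_le_univ Z
    rw [inner V hV, biasedWeight, show Fintype.card Y - #V =
      (Fintype.card Y - #Z) + (#Z - #V) by omega,
      show 1 - (a + (1 - a) * b) = (1 - a) * (1 - b) by ring, mul_pow, mul_pow]
    ring
  simp_rw [← key, Finset.sum_mul, Finset.mul_sum, Finset.sum_mul]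
  rw [Finset.sum_comm]
  rw [Finset.sum_comm]
  conv_rhs => rw [Finset.sum_comm]
  refine Finset.sum_congr rfl fun V _ => ?_
  rw [Finset.sum_comm]
  refine Finset.sum_congr rfl fun W _ => ?_
  simp [mul_assoc]

lemma missProb_eq_zero {p : ℝ} {F : Finset (Finset Y)} (h : ∅ ∈ F) : missProb p F = 0 :=
  Finset.sum_eq_zero fun W _ => by rw [if_pos ⟨∅, h, empty_subset W⟩, mul_zero]

lemma missProb_le_one {p : ℝ} (h0 : 0 ≤ p) (h1 : p ≤ 1) (F : Finset (Finset Y)) :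
    missProb p F ≤ 1 := by
  rw [← sum_biasedWeight (Y := Y) p]
  refine Finset.sum_le_sum fun W _ => ?_
  have := biasedWeight_nonneg h0 h1 W
  split_ifs <;> simp [this]

lemma missProb_union_le (a b : ℝ) (ha0 : 0 ≤ a) (ha1 : a ≤ 1) (hb0 : 0 ≤ b) (hb1 : b ≤ 1)
    (F : Finset (Finset Y)) (P : Finset Y → Prop) [DecidablePred P] :
    missProb (a + b - a * b) F ≤
      ∑ W : Finset Y, biasedWeight a W * missProb b {T ∈ minimalFragments F W | P T} := by
  rw [missProb, ← sum_biasedWeight_union]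
  refine Finset.sum_le_sum fun V _ =>
    mul_le_mul_of_nonneg_left (Finset.sum_le_sum fun W _ =>
      mul_le_mul_of_nonneg_left ?_ (biasedWeight_nonneg hb0 hb1 W)) (biasedWeight_nonneg ha0 ha1 V)
  by_cases h : ∃ E ∈ {T ∈ minimalFragments F V | P T}, E ⊆ W
  · obtain ⟨T, hT, hTW⟩ := h
    obtain ⟨E, hE, rfl⟩ := (mem_minimalFragments.1 (mem_filter.1 hT).1).1
    rw [if_pos ⟨E, hE, sdiff_le_iff.1 hTW⟩]
    split_ifs <;> norm_num
  · rw [if_neg h]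
    split_ifs <;> norm_num

/-- An exponential-moment bound for the weight of large subsets. -/
lemma sum_powerset_card_gt_le {Y : Type*} {S : Finset Y} {r s : ℕ} (hS : #S ≤ r) {x l : ℝ} (hx : 0 ≤ x)
    (hl : 1 ≤ l) :
    ∑ T ∈ S.powerset with s < #T, x ^ #T ≤ (l ^ (s + 1))⁻¹ * (1 + l * x) ^ r := by
  have hl0 : 0 < l := by linarith
  have hs := Finset.sum_pow_mul_eq_add_pow (l * x) 1 S
  have : ∑ T ∈ S.powerset with s < #T, x ^ #T ≤
      ∑ T ∈ S.powerset, (l ^ (s + 1))⁻¹ * ((l * x) ^ #T * 1 ^ (#S - #T)) := by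
    rw [Finset.sum_filter]
    refine Finset.sum_le_sum fun T _ => ?_
    split_ifs with h
    · rw [one_pow, mul_one, mul_pow, ← mul_assoc]
      refine le_mul_of_one_le_left (by positivity) ?_
      rw [inv_mul_eq_div, one_le_div (by positivity)]
      exact pow_le_pow_right₀ hl h
    · positivity
  refine this.trans ?_
  rw [← Finset.mul_sum, hs, add_comm (l * x)]
  have : 1 ≤ 1 + l * x := by nlinarith
  gcongr

/-- The expected weight of the large minimal fragments is small. -/
lemma sum_biasedWeight_minimalFragments_le {F : Finset (Finset Y)} {q p δ : ℝ} {r s : ℕ}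
    (hF : ∀ E ∈ F, #E ≤ r) (hq : 0 ≤ q) (hp0 : 0 < p) (hp1 : p ≤ 1)
    (hδ : ∀ S : Finset Y, #S ≤ r → ∑ T ∈ S.powerset with s < #T, (q / p) ^ #T ≤ δ) :
    ∑ W : Finset Y, biasedWeight p W *
      ∑ T ∈ minimalFragments F W with s < #T, q ^ #T ≤ δ := by
  have hx : 0 ≤ q / p := by positivity
  have hc : ∀ Z : Finset Y, ∃ S : Finset Y, #S ≤ r ∧ ((∃ E ∈ F, E ⊆ Z) → S ∈ F ∧ S ⊆ Z) := by
    intro Z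
    by_cases h : ∃ E ∈ F, E ⊆ Z
    · obtain ⟨E, hE, hEZ⟩ := h
      exact ⟨E, hF E hE, fun _ => ⟨hE, hEZ⟩⟩
    · exact ⟨∅, by simp, fun h' => absurd h' h⟩
  choose c hcr hc using hc
  have hfrag : ∀ W T : Finset Y, T ∈ minimalFragments F W → Disjoint W T ∧ T ⊆ c (W ∪ T) := by
    intro W T hT
    obtain ⟨⟨E, hE, rfl⟩, h2⟩ := mem_minimalFragments.1 hT
    refine ⟨disjoint_sdiff, ?_⟩
    obtain ⟨hS, hSZ⟩ := hc (W ∪ E \ W) ⟨E, hE, by simp⟩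
    have := h2 _ hS (sdiff_le_iff.2 hSZ)
    exact this.symm.subset.trans Finset.sdiff_subset
  calc _ = ∑ T : Finset Y, ∑ W : Finset Y,
        (if T ∈ minimalFragments F W ∧ s < #T then biasedWeight p W * q ^ #T else 0) := by
        rw [Finset.sum_comm]
        refine Finset.sum_congr rfl fun W _ => ?_
        rw [Finset.mul_sum, ← Finset.sum_filter]
        refine Finset.sum_congr ?_ fun _ _ => rfl
        ext T
        simp
    _ ≤ ∑ T : Finset Y, ∑ Z : Finset Y,
        (if T ⊆ c Z ∧ s < #T then biasedWeight p Z * (q / p) ^ #T else 0) := by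
        refine Finset.sum_le_sum fun T _ => ?_
        rw [← Finset.sum_filter, ← Finset.sum_filter]
        calc _ ≤ ∑ W : Finset Y with T ∈ minimalFragments F W ∧ s < #T,
              biasedWeight p (W ∪ T) * (q / p) ^ #T := by
              refine Finset.sum_le_sum fun W hW => ?_
              have hd := (hfrag W T (mem_filter.1 hW).2.1).1
              have hcard := card_union_of_disjoint hd
              have hle := card_le_univ (W ∪ T)
              rw [biasedWeight, biasedWeight, hcard, div_pow, pow_add]
              rw [hcard] at hle
              have h2 : (1 - p) ^ (Fintype.card Y - #W) ≤
                  (1 - p) ^ (Fintype.card Y - (#W + #T)) :=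
                pow_le_pow_of_le_one (by linarith) (by linarith) (by omega)
              have hpT : p ^ #T ≠ 0 := by positivity
              have : p ^ #W * p ^ #T * (1 - p) ^ (Fintype.card Y - (#W + #T)) *
                  (q ^ #T / p ^ #T) =
                  p ^ #W * (1 - p) ^ (Fintype.card Y - (#W + #T)) * q ^ #T := by
                field_simp
              rw [this]
              gcongr
          _ = ∑ Z ∈ image (· ∪ T) {W : Finset Y | T ∈ minimalFragments F W ∧ s < #T},
              biasedWeight p Z * (q / p) ^ #T := by
              rw [Finset.sum_image]
              intro W hW W' hW' h
              have hd := (hfrag W T (mem_filter.1 hW).2.1).1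
              have hd' := (hfrag W' T (mem_filter.1 hW').2.1).1
              have := congrArg (fun V : Finset Y => V \ T) h
              simpa [union_sdiff_distrib, sdiff_eq_self_of_disjoint hd,
                sdiff_eq_self_of_disjoint hd'] using this
          _ ≤ _ := by
              refine Finset.sum_le_sum_of_subset_of_nonneg ?_ fun Z _ _ =>
                mul_nonneg (biasedWeight_nonneg hp0.le hp1 Z) (pow_nonneg hx _)
              intro Z hZ
              obtain ⟨W, hW, rfl⟩ := mem_image.1 hZ
              have hW := (mem_filter.1 hW).2
              exact mem_filter.2 ⟨mem_univ _, (hfrag W T hW.1).2, hW.2⟩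
    _ = ∑ Z : Finset Y, biasedWeight p Z *
        ∑ T ∈ (c Z).powerset with s < #T, (q / p) ^ #T := by
        rw [Finset.sum_comm]
        refine Finset.sum_congr rfl fun Z _ => ?_
        rw [Finset.mul_sum, ← Finset.sum_filter]
        refine Finset.sum_congr ?_ fun _ _ => rfl
        ext T
        simp
    _ ≤ ∑ Z : Finset Y, biasedWeight p Z * δ :=
        Finset.sum_le_sum fun Z _ =>
          mul_le_mul_of_nonneg_left (hδ _ (hcr Z)) (biasedWeight_nonneg hp0.le hp1 Z)
    _ = δ := by rw [← Finset.sum_mul, sum_biasedWeight, one_mul]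

/-- Exposing one `a`-random set reduces an `r`-bounded family to an `s`-bounded one. -/
lemma missProb_le_of_step {ι : Type*} [Fintype ι] {h : ι → Finset Y} {q : ℝ} (hq0 : 0 ≤ q)
    (hq : ∀ S : Finset Y, (#{i | S ⊆ h i} : ℝ) ≤ q ^ #S * Fintype.card ι)
    {F : Finset (Finset Y)} {a b δ e : ℝ} {r s : ℕ} (hF : ∀ E ∈ F, #E ≤ r)
    (ha0 : 0 < a) (ha1 : a ≤ 1) (hb0 : 0 ≤ b) (hb1 : b ≤ 1)
    (hδ : ∀ S : Finset Y, #S ≤ r → ∑ T ∈ S.powerset with s < #T, (q / a) ^ #T ≤ δ)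
    (hnext : ∀ F' : Finset (Finset Y), (∀ E ∈ F', #E ≤ s) →
      missProb b F' ≤ 1 - coverRatio h F' + e) :
    missProb (a + b - a * b) F ≤ 1 - coverRatio h F + (e + δ) := by
  calc missProb (a + b - a * b) F
      ≤ ∑ W : Finset Y, biasedWeight a W * missProb b {T ∈ minimalFragments F W | #T ≤ s} :=
        missProb_union_le a b ha0.le ha1 hb0 hb1 F (#· ≤ s)
    _ ≤ ∑ W : Finset Y, (biasedWeight a W * (1 - coverRatio h F + e) +
          biasedWeight a W * ∑ T ∈ minimalFragments F W with s < #T, q ^ #T) := by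
        refine Finset.sum_le_sum fun W _ => ?_
        rw [← mul_add]
        refine mul_le_mul_of_nonneg_left ?_ (biasedWeight_nonneg ha0.le ha1 W)
        have h1 := hnext {T ∈ minimalFragments F W | #T ≤ s} fun E hE => (mem_filter.1 hE).2
        have h2 : coverRatio h F ≤ coverRatio h {T ∈ minimalFragments F W | #T ≤ s} +
            ∑ T ∈ minimalFragments F W with s < #T, q ^ #T := by
          refine coverRatio_le_add hq0 hq fun E hE => ?_
          obtain ⟨T, hT, hTE⟩ := exists_minimalFragments_subset W hE
          refine ⟨T, ?_, hTE⟩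
          rcases le_or_gt #T s with hs | hs <;> simp [hT, hs]
        linarith
    _ ≤ 1 - coverRatio h F + (e + δ) := by
        rw [Finset.sum_add_distrib, ← Finset.sum_mul, sum_biasedWeight]
        linarith [sum_biasedWeight_minimalFragments_le hF hq0 ha0 ha1 hδ]

lemma missProb_zero_le {ι : Type*} [Fintype ι] (h : ι → Finset Y) {F : Finset (Finset Y)}
    (hF : ∀ E ∈ F, #E ≤ 0) : missProb 0 F ≤ 1 - coverRatio h F + 0 := by
  rcases F.eq_empty_or_nonempty with rfl | ⟨E, hE⟩
  · simpa [coverRatio] using missProb_le_one le_rfl zero_le_one (∅ : Finset (Finset Y))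
  · have : E = ∅ := card_eq_zero.1 (Nat.le_zero.1 (hF E hE))
    rw [missProb_eq_zero (this ▸ hE)]
    linarith [coverRatio_le_one h F]

/-- Repeated halving of the edge sizes down to `s`, followed by one last exposure. -/
lemma missProb_le_of_spread {ι : Type*} [Fintype ι] {h : ι → Finset Y} {q : ℝ} (hq0 : 0 < q)
    (hq : ∀ S : Finset Y, (#{i | S ⊆ h i} : ℝ) ≤ q ^ #S * Fintype.card ι) {s N : ℕ}
    (hs : 1 ≤ s) (hN : 1 ≤ N) (n : ℕ) :
    ∀ (p : ℝ) (F : Finset (Finset Y)), (∀ E ∈ F, #E ≤ 2 ^ n * s) → 16 * (n + N) * q ≤ p →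
      p ≤ 1 → missProb p F ≤ 1 - coverRatio h F +
        (2 ^ s / (16 * N) + (1 / 2) ^ s * (1 - (1 / 2) ^ n)) := by
  have hN' : (1 : ℝ) ≤ N := by exact_mod_cast hN
  induction n with
  | zero =>
    intro p F hF hp hp1
    have hp0 : 0 < p := lt_of_lt_of_le (by positivity) hp
    have hx : q / p ≤ 1 / (16 * N) := by
      rw [div_le_div_iff₀ hp0 (by positivity)]
      push_cast at hp
      linarith
    have key := missProb_le_of_step (s := 0) (b := 0) (e := 0) (δ := 2 ^ s / (16 * N)) hq0.le hq
      hF hp0 hp1 le_rfl zero_le_one (fun S hS => ?_) fun F' hF' => missProb_zero_le h hF'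
    · simpa using key
    · rw [pow_zero, one_mul] at hS
      have hl : 1 ≤ 16 * (N : ℝ) := by linarith
      refine (sum_powerset_card_gt_le hS (by positivity) hl).trans ?_
      have : 1 + 16 * N * (q / p) ≤ 2 := by
        rw [le_div_iff₀ (by positivity)] at hx
        linarith
      rw [zero_add, pow_one, inv_mul_eq_div]
      gcongr
  | succ n ih =>
    intro p F hF hp hp1
    push_cast at hp
    have hn : (0 : ℝ) ≤ n := n.cast_nonneg
    have hlt : 16 * q < 1 := by nlinarith [mul_nonneg hn hq0.le]
    have h1 : 0 < 1 - 16 * q := by linarith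
    set b := (p - 16 * q) / (1 - 16 * q) with hb
    have hpq : 16 * (n + N) * q ≤ p - 16 * q := by linarith
    have hpq0 : 0 ≤ p - 16 * q := le_trans (by positivity) hpq
    have hb1 : b ≤ 1 := by rw [hb, div_le_one h1]; linarith
    have hb0 : 0 ≤ b := div_nonneg hpq0 h1.le
    have hpb : p = 16 * q + b - 16 * q * b := by
      have : b * (1 - 16 * q) = p - 16 * q := div_mul_cancel₀ _ h1.ne'
      linarith
    have hbn : 16 * (n + N) * q ≤ b := by
      rw [hb, le_div_iff₀ h1]
      have : 0 ≤ 16 * (n + N) * q := by positivity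
      nlinarith
    rw [hpb]
    have key := missProb_le_of_step (s := 2 ^ n * s) (δ := (1 / 2) ^ s * (1 / 2) ^ (n + 1)) hq0.le
      hq hF (by positivity) hlt.le hb0 hb1 (fun S hS => ?_) fun F' hF' => ih b F' hF' hbn hb1
    · refine key.trans (le_of_eq ?_)
      rw [pow_succ]
      ring
    · refine (sum_powerset_card_gt_le hS (by positivity) (l := 16) (by norm_num)).trans ?_
      have e1 : 1 + 16 * (q / (16 * q)) = 2 := by field_simp; norm_num
      rw [e1, ← pow_add]
      have e2 : (2 : ℝ) ^ (2 ^ (n + 1) * s) = (4 : ℝ) ^ (2 ^ n * s) := by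
        rw [pow_succ, mul_assoc, mul_comm, mul_assoc, mul_comm s, pow_mul]
        norm_num
      have e3 : ((16 : ℝ) ^ (2 ^ n * s + 1))⁻¹ * 4 ^ (2 ^ n * s) ≤ (1 / 2) ^ (2 * (2 ^ n * s)) := by
        have e4 : (16 : ℝ) ^ (2 ^ n * s) = 4 ^ (2 ^ n * s) * 4 ^ (2 ^ n * s) := by
          rw [← mul_pow]; norm_num
        have e5 : ((1 : ℝ) / 2) ^ (2 * (2 ^ n * s)) = (4 ^ (2 ^ n * s))⁻¹ := by
          rw [pow_mul, ← inv_pow]; norm_num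
        have e6 : (0 : ℝ) < 4 ^ (2 ^ n * s) := by positivity
        rw [e5, pow_succ, e4, inv_mul_le_iff₀ (by positivity)]
        field_simp
        norm_num
      rw [e2]
      refine e3.trans (pow_le_pow_of_le_one (by norm_num) (by norm_num) ?_)
      have : n + 1 ≤ 2 ^ n := Nat.lt_two_pow_self
      nlinarith

/-- The spread lemma with an explicit failure probability. -/
lemma missProb_range_le {ι : Type*} [Fintype ι] [Nonempty ι] {h : ι → Finset Y} {q p : ℝ} {r : ℕ}
    (hq0 : 0 < q) (hq : ∀ S : Finset Y, (#{i | S ⊆ h i} : ℝ) ≤ q ^ #S * Fintype.card ι)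
    (hr : ∀ i, #(h i) ≤ r) (hp : 32 * (Nat.log 2 r + 1 : ℕ) * q ≤ p) (hp1 : p ≤ 1)
    {F : Finset (Finset Y)} (hF : ∀ E, E ∈ F ↔ ∃ i, h i = E) :
    missProb p F ≤ 2 / Nat.sqrt (Nat.log 2 r + 1) := by
  set n := Nat.log 2 r + 1 with hn
  set m := Nat.sqrt n with hm
  have hm0 : 0 < m := Nat.sqrt_pos.2 (by omega)
  have hmn : m * m ≤ n := Nat.sqrt_le n
  have hrn : r < 2 ^ n := Nat.lt_pow_succ_log_self (by norm_num) r
  have key := missProb_le_of_spread (s := Nat.log 2 m + 1) (N := n) hq0 hq (by omega) (by omega) n p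
    F (fun E hE => ?_) (by linarith) hp1
  · have hcov : coverRatio h F = 1 := by
      rw [coverRatio, filter_true_of_mem fun i _ =>
        ⟨h i, (hF _).2 ⟨i, rfl⟩, Subset.rfl⟩, card_univ, div_self]
      exact_mod_cast Fintype.card_ne_zero
    rw [hcov] at key
    have hm0' : (0 : ℝ) < m := by exact_mod_cast hm0
    have hmn' : (m : ℝ) * m ≤ n := by exact_mod_cast hmn
    have hn0 : (0 : ℝ) < n := by exact_mod_cast Nat.succ_pos _
    have l1 : (2 : ℝ) ^ (Nat.log 2 m + 1) ≤ 2 * m := by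
      rw [pow_succ, mul_comm]
      have := Nat.pow_log_le_self 2 hm0.ne'
      have : (2 : ℝ) ^ Nat.log 2 m ≤ m := by exact_mod_cast this
      linarith
    have l2 : (m : ℝ) ≤ 2 ^ (Nat.log 2 m + 1) := by
      exact_mod_cast (Nat.lt_pow_succ_log_self (by norm_num) m).le
    have t1 : (2 : ℝ) ^ (Nat.log 2 m + 1) / (16 * n) ≤ 1 / m := by
      rw [div_le_div_iff₀ (by positivity) hm0']
      nlinarith
    have t2 : (1 / 2 : ℝ) ^ (Nat.log 2 m + 1) ≤ 1 / m := by
      rw [one_div_pow]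
      exact one_div_le_one_div_of_le hm0' l2
    have t3 : (1 / 2 : ℝ) ^ (Nat.log 2 m + 1) * (1 - (1 / 2) ^ n) ≤
        (1 / 2 : ℝ) ^ (Nat.log 2 m + 1) :=
      mul_le_of_le_one_right (by positivity) (by linarith [show (0 : ℝ) < (1 / 2) ^ n by positivity])
    have : (2 : ℝ) / m = 1 / m + 1 / m := by ring
    linarith
  · obtain ⟨i, rfl⟩ := (hF E).1 hE
    exact (hr i).trans (hrn.le.trans (Nat.le_mul_of_pos_right _ (by omega)))

end Biased

/-- Coordinatewise comparison of expectations under two product weights. -/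
lemma sum_prod_mul_le_fin {A B Ω : Type*} [Fintype A] [Fintype B] [Nonempty Ω]
    {u : A → ℝ} {v : B → ℝ} (hu : ∀ a, 0 ≤ u a) (hv : ∀ b, 0 ≤ v b) (φ : A → Ω) (ψ : B → Ω)
    (n : ℕ) : ∀ g : (Fin n → Ω) → ℝ,
      (∀ x f, ∑ a, u a * g (Function.update f x (φ a)) ≤
        ∑ b, v b * g (Function.update f x (ψ b))) →
      ∑ a : Fin n → A, (∏ x, u (a x)) * g (φ ∘ a) ≤
        ∑ b : Fin n → B, (∏ x, v (b x)) * g (ψ ∘ b) := by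
  induction n with
  | zero =>
    intro g _
    simp [Subsingleton.elim (φ ∘ _) (ψ ∘ (default : Fin 0 → B))]
  | succ n ih =>
    intro g hg
    obtain ⟨ω⟩ := ‹Nonempty Ω›
    have hA : ∀ a a', φ ∘ Fin.consEquiv (fun _ : Fin (n + 1) => A) (a, a') =
        Fin.cons (φ a) (φ ∘ a') := fun a a' => funext (Fin.cases rfl fun _ => rfl)
    have hB : ∀ b b', ψ ∘ Fin.consEquiv (fun _ : Fin (n + 1) => B) (b, b') =
        Fin.cons (ψ b) (ψ ∘ b') := fun b b' => funext (Fin.cases rfl fun _ => rfl)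
    rw [← (Fin.consEquiv fun _ => A).sum_comp, ← (Fin.consEquiv fun _ => B).sum_comp,
      Fintype.sum_prod_type, Fintype.sum_prod_type]
    simp only [hA, hB]
    simp only [Fin.consEquiv_apply, Fin.prod_univ_succ, Fin.cons_zero, Fin.cons_succ]
    calc _ = ∑ a' : Fin n → A, (∏ x, u (a' x)) * ∑ a, u a * g (Fin.cons (φ a) (φ ∘ a')) := by
          rw [Finset.sum_comm]
          simp_rw [Finset.mul_sum]
          refine Finset.sum_congr rfl fun a' _ => Finset.sum_congr rfl fun a _ => by ring
      _ ≤ ∑ a' : Fin n → A, (∏ x, u (a' x)) * ∑ b, v b * g (Fin.cons (ψ b) (φ ∘ a')) := by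
          refine Finset.sum_le_sum fun a' _ =>
            mul_le_mul_of_nonneg_left ?_ (Finset.prod_nonneg fun x _ => hu _)
          simpa only [Fin.update_cons_zero] using hg 0 (Fin.cons ω (φ ∘ a'))
      _ = ∑ b, v b * ∑ a' : Fin n → A, (∏ x, u (a' x)) * g (Fin.cons (ψ b) (φ ∘ a')) := by
          simp_rw [Finset.mul_sum]
          rw [Finset.sum_comm]
          refine Finset.sum_congr rfl fun a' _ => Finset.sum_congr rfl fun a _ => by ring
      _ ≤ ∑ b, v b * ∑ b' : Fin n → B, (∏ x, v (b' x)) * g (Fin.cons (ψ b) (ψ ∘ b')) := by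
          refine Finset.sum_le_sum fun b _ => mul_le_mul_of_nonneg_left ?_ (hv b)
          refine ih (fun f => g (Fin.cons (ψ b) f)) fun x f => ?_
          simpa only [Fin.cons_update] using hg x.succ (Fin.cons (ψ b) f)
      _ = _ := by
          simp_rw [Finset.mul_sum, mul_assoc]

lemma sum_prod_mul_le {X A B Ω : Type*} [Fintype X] [DecidableEq X] [Fintype A] [Fintype B] [Nonempty Ω]
    {u : A → ℝ} {v : B → ℝ} (hu : ∀ a, 0 ≤ u a) (hv : ∀ b, 0 ≤ v b) (φ : A → Ω) (ψ : B → Ω)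
    (g : (X → Ω) → ℝ)
    (hg : ∀ x f, ∑ a, u a * g (Function.update f x (φ a)) ≤
      ∑ b, v b * g (Function.update f x (ψ b))) :
    ∑ a : X → A, (∏ x, u (a x)) * g (φ ∘ a) ≤ ∑ b : X → B, (∏ x, v (b x)) * g (ψ ∘ b) := by
  let e := (Fintype.equivFin X).symm
  have key := sum_prod_mul_le_fin hu hv φ ψ (Fintype.card X) (fun f => g (f ∘ e.symm))
    fun x f => by
      have := hg (e x) (f ∘ e.symm)
      have hup : ∀ ω, Function.update (f ∘ e.symm) (e x) ω = Function.update f x ω ∘ e.symm :=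
        fun ω => by rw [Function.update_comp_equiv]; rfl
      simpa only [hup] using this
  convert key using 1
  · rw [← (Equiv.arrowCongr e (Equiv.refl A)).sum_comp]
    refine Finset.sum_congr rfl fun a _ => ?_
    congr 1
    rw [← e.prod_comp]
    simp
  · rw [← (Equiv.arrowCongr e (Equiv.refl B)).sum_comp]
    refine Finset.sum_congr rfl fun a _ => ?_
    congr 1
    rw [← e.prod_comp]
    simp

/-- The weight of a color together with the decision whether an element is kept. -/
noncomputable def colorWeight (k : ℕ) (p : ℝ) (a : Fin k × Bool) : ℝ :=
  (k : ℝ)⁻¹ * if a.2 then p else 1 - p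

/-- The set of colors an element contributes: its color if it is kept, nothing otherwise. -/
def keptColor {k : ℕ} (a : Fin k × Bool) : Finset (Fin k) := if a.2 then {a.1} else ∅

/-- The indicator that no set `h i` is contained in the graph of `f`. -/
noncomputable def missIndicator {X ι : Type*} {k : ℕ} (h : ι → Finset (Σ _ : X, Fin k))
    (f : X → Finset (Fin k)) : ℝ :=
  if ∃ i, ∀ y ∈ h i, y.2 ∈ f y.1 then 0 else 1

lemma sum_biasedWeight_disjoint {Y : Type*} [Fintype Y] (q : ℝ) (D : Finset Y) :
    ∑ W : Finset Y, biasedWeight q W * (if Disjoint W D then 1 else 0) = (1 - q) ^ #D := by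
  have hs := Finset.sum_pow_mul_eq_add_pow q (1 - q) Dᶜ
  rw [add_sub_cancel, one_pow] at hs
  simp only [mul_ite, mul_one, mul_zero]
  rw [← Finset.sum_filter]
  have e : (univ.filter fun W : Finset Y => Disjoint W D) = Dᶜ.powerset := by
    ext W
    simp [subset_compl_iff_disjoint_right]
  rw [e]
  trans (1 - q) ^ #D * ∑ W ∈ Dᶜ.powerset, q ^ #W * (1 - q) ^ (#Dᶜ - #W)
  swap
  · rw [hs, mul_one]
  rw [Finset.mul_sum]
  refine Finset.sum_congr rfl fun W hW => ?_
  have h1 := card_le_card (mem_powerset.1 hW)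
  have h2 := card_compl D
  have h3 := card_le_univ D
  rw [biasedWeight, show Fintype.card Y - #W = #D + (#Dᶜ - #W) by omega, pow_add]
  ring

lemma missIndicator_update_le {X ι : Type*} {k : ℕ} {h : ι → Finset (Σ _ : X, Fin k)}
    (hinj : ∀ i, ∀ y ∈ h i, ∀ z ∈ h i, y.1 = z.1 → y = z) (hk : 0 < k) {p : ℝ} (hp1 : p ≤ 1)
    (x : X) (f : X → Finset (Fin k)) :
    ∑ a, colorWeight k p a * missIndicator h (Function.update f x (keptColor a)) ≤
      ∑ D, biasedWeight (p / k) D * missIndicator h (Function.update f x D) := by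
  have hk' : (0 : ℝ) < k := by exact_mod_cast hk
  have hk1 : (1 : ℝ) ≤ k := by exact_mod_cast hk
  by_cases h0 : ∃ i, ∀ y ∈ h i, y.2 ∈ Function.update f x ∅ y.1
  · have hz : ∀ D, missIndicator h (Function.update f x D) = 0 := by
      intro D
      obtain ⟨i, hi⟩ := h0
      refine if_pos ⟨i, fun y hy => ?_⟩
      have := hi y hy
      by_cases hyx : y.1 = x
      · rw [hyx] at this
        simp at this
      · simpa [Function.update_of_ne hyx] using this
    simp [hz]
  · set B : Finset (Fin k) := {c | ∃ i, ∀ y ∈ h i, y.2 ∈ Function.update f x {c} y.1} with hB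
    have hz : ∀ D, missIndicator h (Function.update f x D) = if Disjoint D B then 1 else 0 := by
      intro D
      have hiff : (∃ i, ∀ y ∈ h i, y.2 ∈ Function.update f x D y.1) ↔ ¬ Disjoint D B := by
        rw [not_disjoint_iff]
        constructor
        · rintro ⟨i, hi⟩
          obtain ⟨y, hy, hyx⟩ : ∃ y ∈ h i, y.1 = x := by
            by_contra! hne
            refine h0 ⟨i, fun y hy => ?_⟩
            have := hi y hy
            rwa [Function.update_of_ne (hne y hy)] at this ⊢
          subst hyx
          refine ⟨y.2, by simpa using hi y hy, ?_⟩
          refine mem_filter.2 ⟨mem_univ _, i, fun z hz => ?_⟩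
          by_cases hzy : z.1 = y.1
          · rw [hinj i z hz y hy hzy]
            simp
          · have := hi z hz
            rwa [Function.update_of_ne hzy] at this ⊢
        · rintro ⟨c, hcD, hcB⟩
          obtain ⟨i, hi⟩ := (mem_filter.1 hcB).2
          refine ⟨i, fun y hy => ?_⟩
          have := hi y hy
          by_cases hyx : y.1 = x
          · rw [hyx] at this ⊢
            simp at this ⊢
            rwa [this]
          · rwa [Function.update_of_ne hyx] at this ⊢
      rw [missIndicator]
      by_cases hd : Disjoint D B
      · rw [if_neg (fun h => hiff.1 h hd), if_pos hd]
      · rw [if_pos (hiff.2 hd), if_neg hd]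
    simp_rw [hz]
    have hdisj : ∑ D : Finset (Fin k), biasedWeight (p / k) D *
        (if Disjoint D B then (1 : ℝ) else 0) = (1 - p / k) ^ #B := by
      convert sum_biasedWeight_disjoint (p / k) B
    rw [hdisj, Fintype.sum_prod_type]
    have hbern := one_add_mul_le_pow (a := -(p / k)) (by
      have : p / k ≤ 1 := (div_le_one hk').2 (by linarith)
      linarith) #B
    rw [← sub_eq_add_neg] at hbern
    refine le_trans (le_of_eq ?_) hbern
    have hcard : ∑ c : Fin k, (if c ∈ B then (0 : ℝ) else 1) = k - #B := by
      have : ∑ c : Fin k, (if c ∈ B then (0 : ℝ) else 1) =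
          ∑ c : Fin k, (1 - if c ∈ B then (1 : ℝ) else 0) :=
        Finset.sum_congr rfl fun c _ => by split_ifs <;> simp
      rw [this, Finset.sum_sub_distrib]
      simp
    have : ∀ c : Fin k, ∑ b : Bool, colorWeight k p (c, b) *
        (if Disjoint (keptColor (c, b)) B then (1 : ℝ) else 0) =
        (k : ℝ)⁻¹ * (1 - p) + (k : ℝ)⁻¹ * p * (if c ∈ B then 0 else 1) := by
      intro c
      by_cases hc : c ∈ B <;> simp [colorWeight, keptColor, hc]
      ring
    simp_rw [this]
    rw [Finset.sum_add_distrib, Finset.sum_const, ← Finset.mul_sum, hcard]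
    simp
    field_simp
    ring

section Colored

variable {X : Type*} [Fintype X] {k : ℕ}

lemma biasedWeight_sigma (q : ℝ) (f : X → Finset (Fin k)) :
    biasedWeight q (univ.sigma f : Finset (Σ _ : X, Fin k)) = ∏ x, biasedWeight q (f x) := by
  simp only [biasedWeight]
  rw [Finset.prod_mul_distrib, Finset.prod_pow_eq_pow_sum, Finset.prod_pow_eq_pow_sum, card_sigma,
    Fintype.card_sigma, Finset.sum_tsub_distrib _ fun x _ => card_le_univ _]

lemma sum_prod_biasedWeight_eq_missProb [DecidableEq X] {ι : Type*} (h : ι → Finset (Σ _ : X, Fin k)) (q : ℝ)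
    {F : Finset (Finset (Σ _ : X, Fin k))} (hF : ∀ E, E ∈ F ↔ ∃ i, h i = E) :
    ∑ f : X → Finset (Fin k), (∏ x, biasedWeight q (f x)) * missIndicator h f = missProb q F := by
  rw [missProb]
  refine Finset.sum_bij' (fun f _ => (univ.sigma f : Finset (Σ _ : X, Fin k)))
    (fun W _ x => {c | (⟨x, c⟩ : Σ _ : X, Fin k) ∈ W}) (by simp) (by simp) ?_ ?_ ?_
  · intro f _
    ext x c
    simp
  · intro W _
    ext ⟨x, c⟩
    simp
  · intro f _
    rw [biasedWeight_sigma, missIndicator]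
    congr 1
    have hiff : (∃ i, ∀ y ∈ h i, y.2 ∈ f y.1) ↔ ∃ E ∈ F, E ⊆ univ.sigma f := by
      simp [hF, subset_iff]
    split_ifs with h1 h2 h2
    · rfl
    · exact absurd (hiff.1 h1) h2
    · exact absurd (hiff.2 h2) h1
    · rfl

end Colored

/-- Replacing the random coloring of a random set by independent random color lists can only
decrease the probability of containing one of the sets `h i`. -/
lemma one_sub_missProb_le_rainbowProb {X ι : Type*} [Fintype X] [DecidableEq X] {k : ℕ}
    (hk : 0 < k) {h : ι → Finset (Σ _ : X, Fin k)} {H : Multiset (Finset X)} {p : ℝ}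
    (hp0 : 0 ≤ p) (hp1 : p ≤ 1)
    (hinj : ∀ i, ∀ y ∈ h i, ∀ z ∈ h i, y.1 = z.1 → y = z)
    (hH : ∀ (i : ι) (c : X → Fin k) (W : Finset X), (∀ y ∈ h i, y.1 ∈ W ∧ c y.1 = y.2) →
      ∃ E ∈ H, E ⊆ W ∧ Set.InjOn c ↑E)
    {F : Finset (Finset (Σ _ : X, Fin k))} (hF : ∀ E, E ∈ F ↔ ∃ i, h i = E) :
    1 - missProb (p / k) F ≤ rainbowProb k p H := by
  have hk' : (0 : ℝ) < k := by exact_mod_cast hk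
  have hk1 : (1 : ℝ) ≤ k := by exact_mod_cast hk
  have hcmp := sum_prod_mul_le (X := X) (u := colorWeight k p) (v := biasedWeight (p / k))
    (fun a => by
      rw [colorWeight]
      split_ifs
      · positivity
      · exact mul_nonneg (by positivity) (by linarith))
    (fun D => biasedWeight_nonneg (by positivity) ((div_le_one hk').2 (by linarith)) D)
    keptColor id (missIndicator h) fun x f => by
      convert missIndicator_update_le hinj hk hp1 x f
      rfl
  have hA := sum_prod_biasedWeight_eq_missProb h (p / k) hF
  have hB : ∑ a : X → Fin k × Bool, (∏ x, colorWeight k p (a x)) * missIndicator h (keptColor ∘ a) =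
      ∑ c : X → Fin k, ∑ W : Finset X, ((k : ℝ) ^ Fintype.card X)⁻¹ * biasedWeight p W *
        missIndicator h fun x => keptColor (c x, decide (x ∈ W)) := by
    rw [← Fintype.sum_prod_type']
    refine Finset.sum_bij' (fun a _ => (fun x => (a x).1, ({x | (a x).2} : Finset X)))
      (fun cW _ x => (cW.1 x, decide (x ∈ cW.2))) (by simp) (by simp) ?_ ?_ ?_
    · intro a _
      ext x <;> simp
    · intro cW _
      ext x <;> simp
    · intro a _
      congr 1
      · simp only [colorWeight, biasedWeight]
        rw [Finset.prod_mul_distrib, Finset.prod_ite]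
        have hc : #({x | ¬ (a x).2 = true} : Finset X) =
            Fintype.card X - #({x | (a x).2 = true} : Finset X) := by
          rw [← card_compl, compl_filter]
        rw [Finset.prod_const, Finset.prod_const, Finset.prod_const, hc, card_univ, inv_pow]
      · congr 1
        funext x
        simp
  have hone : ∑ c : X → Fin k, ∑ W : Finset X,
      ((k : ℝ) ^ Fintype.card X)⁻¹ * biasedWeight p W = 1 := by
    simp_rw [← Finset.mul_sum, sum_biasedWeight]
    simp
    field_simp
  have hle : (1 : ℝ) ≤ rainbowProb k p H + ∑ c : X → Fin k, ∑ W : Finset X,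
      ((k : ℝ) ^ Fintype.card X)⁻¹ * biasedWeight p W *
        missIndicator h fun x => keptColor (c x, decide (x ∈ W)) := by
    rw [← hone, rainbowProb, ← Finset.sum_add_distrib]
    refine Finset.sum_le_sum fun c _ => ?_
    rw [← Finset.sum_add_distrib]
    refine Finset.sum_le_sum fun W _ => ?_
    rw [mul_assoc _ (p ^ #W), ← biasedWeight.eq_1, ← mul_add]
    refine le_mul_of_one_le_right
      (mul_nonneg (by positivity) (biasedWeight_nonneg hp0 hp1 W)) ?_
    rw [missIndicator]
    split_ifs with h1 h2 h2
    · norm_num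
    · norm_num
    · obtain ⟨i, hi⟩ := h2
      refine absurd (hH i c W fun y hy => ?_) h1
      have := hi y hy
      by_cases hy : y.1 ∈ W
      · simp [keptColor, hy] at this
        exact ⟨hy, this.symm⟩
      · simp [keptColor, hy] at this
    · norm_num
  simp only [Function.id_comp] at hcmp
  rw [hB] at hcmp
  linarith

lemma pow_mul_factorial_sub_le (k : ℕ) : ∀ s ≤ k,
    (k : ℝ) ^ s * (k - s).factorial ≤ Real.exp 1 ^ s * k.factorial := by
  induction k with
  | zero =>
    intro s hs
    obtain rfl := Nat.le_zero.1 hs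
    simp
  | succ k ih =>
    rintro (_ | s) hs
    · simp
    have hsk : s ≤ k := by omega
    have h1 : ((k + 1 : ℕ) : ℝ) ^ s ≤ Real.exp 1 * (k : ℝ) ^ s := by
      rcases k.eq_zero_or_pos with rfl | hk
      · obtain rfl := Nat.le_zero.1 hsk
        simp
      have hk' : (0 : ℝ) < k := by exact_mod_cast hk
      have h2 : ((k + 1 : ℕ) : ℝ) ≤ Real.exp (1 / k) * k := by
        have := mul_le_mul_of_nonneg_right (Real.add_one_le_exp (1 / (k : ℝ))) hk'.le
        rw [add_mul, one_div_mul_cancel hk'.ne'] at this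
        push_cast
        linarith
      refine (pow_le_pow_left₀ (by positivity) h2 s).trans ?_
      rw [mul_pow, ← Real.exp_nat_mul]
      gcongr
      rw [mul_one_div, div_le_one hk']
      exact_mod_cast hsk
    rw [Nat.add_sub_add_right, Nat.factorial_succ, pow_succ, pow_succ]
    push_cast at h1 ⊢
    calc ((k : ℝ) + 1) ^ s * (k + 1) * (k - s).factorial
        ≤ Real.exp 1 * (k : ℝ) ^ s * (k + 1) * (k - s).factorial := by gcongr
      _ = Real.exp 1 * (k + 1) * ((k : ℝ) ^ s * (k - s).factorial) := by ring
      _ ≤ Real.exp 1 * (k + 1) * (Real.exp 1 ^ s * k.factorial) :=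
          mul_le_mul_of_nonneg_left (ih s hsk) (by positivity)
      _ = _ := by ring

/-- At most `(k - |A|)!` permutations of a `k`-set agree pairwise on `A`. -/
lemma card_perm_eqOn_le {β : Type*} [Fintype β] {A : Finset β} {P : Finset (Equiv.Perm β)}
    (hP : ∀ σ ∈ P, ∀ τ ∈ P, ∀ a ∈ A, σ a = τ a) : #P ≤ (Fintype.card β - #A).factorial := by
  rcases P.eq_empty_or_nonempty with rfl | ⟨τ, hτ⟩
  · simp
  have hcard : Fintype.card {σ : Equiv.Perm β // ∀ a, ¬ a ∉ A → σ a = a} =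
      (Fintype.card β - #A).factorial := by
    rw [← Fintype.card_congr (Equiv.Perm.subtypeEquivSubtypePerm (· ∉ A)), Fintype.card_perm]
    congr 1
    rw [Fintype.card_subtype_compl, Fintype.card_coe]
  rw [← hcard, Fintype.card_subtype]
  refine card_le_card_of_injOn (fun σ => τ⁻¹ * σ) ?_ (fun σ _ σ' _ h => mul_left_cancel h)
  intro σ hσ
  refine mem_coe.2 (mem_filter.2 ⟨mem_univ _, fun a ha => ?_⟩)
  rw [Equiv.Perm.mul_apply, hP σ (mem_coe.1 hσ) τ hτ a (not_not.1 ha)]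
  simp

/-- The graph on `E` of the coloring `σ ∘ c`. -/
noncomputable def coloredEdge {X : Type*} {k : ℕ} (E : Finset X) (c : X → Fin k)
    (σ : Equiv.Perm (Fin k)) : Finset (Σ _ : X, Fin k) :=
  E.image fun x => ⟨x, σ (c x)⟩

lemma mem_coloredEdge {X : Type*} {k : ℕ} {E : Finset X} {c : X → Fin k}
    {σ : Equiv.Perm (Fin k)} {y : Σ _ : X, Fin k} :
    y ∈ coloredEdge E c σ ↔ y.1 ∈ E ∧ σ (c y.1) = y.2 := by
  rw [coloredEdge, mem_image]
  constructor
  · rintro ⟨x, hx, rfl⟩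
    exact ⟨hx, rfl⟩
  · rintro ⟨hx, hy⟩
    exact ⟨y.1, hx, by rw [hy]⟩

lemma card_coloredEdge_le {X : Type*} {k : ℕ} (E : Finset X) (c : X → Fin k)
    (σ : Equiv.Perm (Fin k)) : #(coloredEdge E c σ) ≤ #E :=
  card_image_le

lemma card_filter_subset_coloredEdge_le {X : Type*} {k : ℕ} {E : Finset X} {c : X → Fin k}
    (hc : Set.InjOn c E) (S : Finset (Σ _ : X, Fin k)) :
    #{σ | S ⊆ coloredEdge E c σ} ≤
      if S.image Sigma.fst ⊆ E ∧ #(S.image Sigma.fst) = #S ∧ #S ≤ k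
        then (k - #S).factorial else 0 := by
  rcases Finset.eq_empty_or_nonempty {σ | S ⊆ coloredEdge E c σ} with h | ⟨τ, hτ⟩
  · rw [h]
    simp
  have hτ : ∀ y ∈ S, y.1 ∈ E ∧ τ (c y.1) = y.2 :=
    fun y hy => mem_coloredEdge.1 ((mem_filter.1 hτ).2 hy)
  have hSE : S.image Sigma.fst ⊆ E := by
    intro x hx
    obtain ⟨y, hy, rfl⟩ := mem_image.1 hx
    exact (hτ y hy).1
  have hfst : #(S.image Sigma.fst) = #S := by
    refine card_image_of_injOn fun y hy z hz hyz => ?_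
    have h1 := (hτ y hy).2
    have h2 := (hτ z hz).2
    obtain ⟨x, b⟩ := y
    obtain ⟨x', b'⟩ := z
    obtain rfl : x = x' := hyz
    exact Sigma.ext rfl (heq_of_eq (h1.symm.trans h2))
  have hA : #((S.image Sigma.fst).image c) = #S :=
    (card_image_of_injOn (hc.mono (by exact_mod_cast hSE))).trans hfst
  have hk : #S ≤ k := by
    rw [← hA]
    simpa using card_le_univ ((S.image Sigma.fst).image c)
  rw [if_pos ⟨hSE, hfst, hk⟩]
  have key := card_perm_eqOn_le (A := (S.image Sigma.fst).image c)
    (P := {σ | S ⊆ coloredEdge E c σ}) fun σ hσ ρ hρ a ha => by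
      obtain ⟨x, hx, rfl⟩ := mem_image.1 ha
      obtain ⟨y, hy, rfl⟩ := mem_image.1 hx
      rw [(mem_coloredEdge.1 ((mem_filter.1 hσ).2 hy)).2,
        (mem_coloredEdge.1 ((mem_filter.1 hρ).2 hy)).2]
  rwa [hA, Fintype.card_fin] at key

/-- Coloring the edges of a `κ`-spread hypergraph by random injections into `[k]` makes it
`κ k / e`-spread. -/
lemma card_filter_subset_coloredEdge_le_pow {X ι : Type*} [Fintype ι] {k : ℕ} (hk : 0 < k)
    {κ : ℝ} (hκ : 0 < κ) {E : ι → Finset X} {c : ι → X → Fin k} (hc : ∀ i, Set.InjOn (c i) (E i))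
    (hE : ∀ S : Finset X, (#{i | S ⊆ E i} : ℝ) ≤ κ⁻¹ ^ #S * Fintype.card ι)
    (S : Finset (Σ _ : X, Fin k)) :
    (#{i : ι × Equiv.Perm (Fin k) | S ⊆ coloredEdge (E i.1) (c i.1) i.2} : ℝ) ≤
      (Real.exp 1 / (κ * k)) ^ #S * Fintype.card (ι × Equiv.Perm (Fin k)) := by
  have hk' : (0 : ℝ) < k := by exact_mod_cast hk
  have h1 : #{i : ι × Equiv.Perm (Fin k) | S ⊆ coloredEdge (E i.1) (c i.1) i.2} =
      ∑ i, #{σ | S ⊆ coloredEdge (E i) (c i) σ} := by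
    simp_rw [card_filter]
    rw [Fintype.sum_prod_type]
  have h2 : #{i : ι × Equiv.Perm (Fin k) | S ⊆ coloredEdge (E i.1) (c i.1) i.2} ≤
      ∑ i, if S.image Sigma.fst ⊆ E i ∧ #(S.image Sigma.fst) = #S ∧ #S ≤ k
        then (k - #S).factorial else 0 :=
    h1.trans_le (Finset.sum_le_sum fun i _ => card_filter_subset_coloredEdge_le (hc i) S)
  by_cases hS : #(S.image Sigma.fst) = #S ∧ #S ≤ k
  · simp only [hS, and_true] at h2
    rw [← Finset.sum_filter, Finset.sum_const, smul_eq_mul] at h2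
    have h3 := hE (S.image Sigma.fst)
    rw [hS.1] at h3
    have h4 := pow_mul_factorial_sub_le k #S hS.2
    have h5 : ((k - #S).factorial : ℝ) ≤ (Real.exp 1 / k) ^ #S * k.factorial := by
      rw [div_pow, div_mul_eq_mul_div, le_div_iff₀ (by positivity)]
      linarith
    calc (#{i : ι × Equiv.Perm (Fin k) | S ⊆ coloredEdge (E i.1) (c i.1) i.2} : ℝ)
        ≤ #{i | S.image Sigma.fst ⊆ E i} * (k - #S).factorial := by exact_mod_cast h2
      _ ≤ (κ⁻¹ ^ #S * Fintype.card ι) * ((Real.exp 1 / k) ^ #S * k.factorial) := by gcongr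
      _ = _ := by
        rw [Fintype.card_prod, Fintype.card_perm, Fintype.card_fin]
        push_cast
        rw [show Real.exp 1 / (κ * k) = κ⁻¹ * (Real.exp 1 / k) by field_simp, mul_pow]
        ring
  · simp only [hS, and_false, if_false, Finset.sum_const_zero] at h2
    rw [Nat.le_zero.1 h2, Nat.cast_zero]
    positivity

lemma exists_injOn_fin {X : Type*} {k : ℕ} (hk : 0 < k) {E : Finset X} (hE : #E ≤ k) :
    ∃ c : X → Fin k, Set.InjOn c E := by
  obtain ⟨f⟩ : Nonempty (E ↪ Fin k) := Function.Embedding.nonempty_of_card_le (by simpa using hE)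
  refine ⟨fun x => if hx : x ∈ E then f ⟨x, hx⟩ else ⟨0, hk⟩, fun x hx y hy h => ?_⟩
  have hx := mem_coe.1 hx
  have hy := mem_coe.1 hy
  simp only [hx, hy, dif_pos] at h
  simpa using f.injective h

lemma Spread.card_filter_toType_le {α : Type*} [DecidableEq α] {κ : ℝ} {H : Multiset (Finset α)}
    (h : Spread κ H) (S : Finset α) :
    (#{i : H | S ⊆ i.1} : ℝ) ≤ κ⁻¹ ^ #S * Fintype.card H := by
  have e : #{i : H | S ⊆ i.1} = (H.filter fun E => S ⊆ E).card := by
    conv_rhs => rw [← Multiset.map_univ_coe H]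
    rw [Multiset.filter_map, Multiset.card_map]
    rfl
  rw [e, Multiset.card_coe]
  exact h S

lemma tendsto_two_div_sqrt_log :
    Filter.Tendsto (fun r : ℕ => (2 : ℝ) / Nat.sqrt (Nat.log 2 r + 1)) Filter.atTop (nhds 0) := by
  have : Filter.Tendsto (fun r : ℕ => Nat.sqrt (Nat.log 2 r + 1)) Filter.atTop Filter.atTop := by
    refine Filter.tendsto_atTop.2 fun b => ?_
    filter_upwards [Filter.eventually_ge_atTop (2 ^ (b * b))] with r hr
    have := Nat.le_log_of_pow_le (by norm_num) hr
    exact Nat.le_sqrt.2 (by omega)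
  exact tendsto_const_nhds.div_atTop (tendsto_natCast_atTop_atTop.comp this)

lemma log_two_add_one_mul_exp_le {r : ℕ} (hr : 2 ≤ r) :
    32 * ((Nat.log 2 r + 1 : ℕ) : ℝ) * Real.exp 1 ≤ 300 * Real.log r := by
  have h1 := Real.natLog_le_logb r 2
  have hr' : (2 : ℝ) ≤ r := by exact_mod_cast hr
  have hl2 := Real.log_two_gt_d9
  have he := Real.exp_one_lt_d9
  have hlog : Real.log 2 ≤ Real.log r := Real.log_le_log (by norm_num) hr'
  rw [Real.logb, le_div_iff₀ (by push_cast; linarith)] at h1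
  push_cast at h1 ⊢
  have hn : (0 : ℝ) ≤ Nat.log 2 r := Nat.cast_nonneg _
  have h2 : (Nat.log 2 r + 1) * Real.log 2 ≤ 2 * Real.log r := by linarith
  have h3 : ((Nat.log 2 r : ℝ) + 1) * 0.69 ≤ (Nat.log 2 r + 1) * Real.log 2 := by
    gcongr
    linarith
  have h4 : 32 * ((Nat.log 2 r : ℝ) + 1) * Real.exp 1 ≤ 32 * ((Nat.log 2 r : ℝ) + 1) * 2.72 := by
    gcongr
    linarith
  linarith

/-- There are an absolute constant `C > 0` and `ε : ℕ → [0,1]` with `ε(r) → 0` such that: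
for every `r`-bounded `κ`-spread multi-hypergraph `H` with `r ≥ 2`, every `k ≥ r`, and
every `C log r / κ ≤ p ≤ 1`, if each element of `X = V(H)` is colored independently and
uniformly at random from `[k]`, then with probability at least `1 - ε(r)` the random
subset `X_p` contains a rainbow edge of `H`. -/
theorem rainbow_spread_threshold :
    ∃ C : ℝ, 0 < C ∧ ∃ ε : ℕ → ℝ, (∀ r, 0 ≤ ε r ∧ ε r ≤ 1) ∧
      Filter.Tendsto ε Filter.atTop (nhds 0) ∧
      ∀ (α : Type) [Fintype α] [DecidableEq α],
        ∀ (H : Multiset (Finset α)) (r k : ℕ) (κ p : ℝ),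
          2 ≤ r → 0 < κ → H ≠ 0 → (∀ E ∈ H, E.card ≤ r) → Spread κ H → r ≤ k →
          C * Real.log r / κ ≤ p → p ≤ 1 →
          1 - ε r ≤ rainbowProb k p H := by
  refine ⟨300, by norm_num, fun r => min 1 (2 / Nat.sqrt (Nat.log 2 r + 1)),
    fun r => ⟨le_min zero_le_one (by positivity), min_le_left _ _⟩, ?_, ?_⟩
  · have := (tendsto_const_nhds (x := (1 : ℝ))).min tendsto_two_div_sqrt_log
    rwa [min_eq_right zero_le_one] at this
  intro α _ _ H r k κ p hr hκ hH hcard hspread hrk hp hp1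
  have hk : 0 < k := by omega
  have hk' : (0 : ℝ) < k := by exact_mod_cast hk
  have hk1 : (1 : ℝ) ≤ k := by exact_mod_cast hk
  have hr' : (1 : ℝ) ≤ r := by exact_mod_cast (by omega : 1 ≤ r)
  have hp0 : 0 ≤ p :=
    (div_nonneg (mul_nonneg (by norm_num) (Real.log_nonneg hr')) hκ.le).trans hp
  have hex : ∀ i : H, ∃ c : α → Fin k, Set.InjOn c i.1 := fun i =>
    exists_injOn_fin hk ((hcard i.1 (Multiset.coe_mem)).trans hrk)
  choose c hc using hex
  have : Nonempty H := by
    obtain ⟨E, hE⟩ := Multiset.exists_mem_of_ne_zero hH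
    exact ⟨⟨E, ⟨0, Multiset.count_pos.2 hE⟩⟩⟩
  let h : H × Equiv.Perm (Fin k) → Finset (Σ _ : α, Fin k) :=
    fun i => coloredEdge i.1.1 (c i.1) i.2
  have hF : ∀ E, E ∈ univ.image h ↔ ∃ i, h i = E := fun E => by simp
  have hmiss : missProb (p / k) (univ.image h) ≤ 2 / Nat.sqrt (Nat.log 2 r + 1) := by
    refine missProb_range_le (q := Real.exp 1 / (κ * k)) (by positivity) (fun S => ?_)
      (fun i => (card_coloredEdge_le _ _ _).trans (hcard _ Multiset.coe_mem)) ?_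
      ((div_le_one hk').2 (by linarith)) hF
    · convert card_filter_subset_coloredEdge_le_pow hk hκ hc (fun S => ?_) S
      convert hspread.card_filter_toType_le S
    · have := log_two_add_one_mul_exp_le hr
      rw [div_le_iff₀ hκ] at hp
      rw [← mul_div_assoc, div_le_div_iff₀ (by positivity) hk']
      nlinarith
  have hrainbow : 1 - missProb (p / k) (univ.image h) ≤ rainbowProb k p H := by
    refine one_sub_missProb_le_rainbowProb hk hp0 hp1 ?_ ?_ hF
    · rintro i ⟨x, a⟩ hy ⟨x', a'⟩ hz hyz
      obtain rfl : x = x' := hyz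
      exact Sigma.ext rfl (heq_of_eq ((mem_coloredEdge.1 hy).2.symm.trans (mem_coloredEdge.1 hz).2))
    · intro i col W hW
      have hcol : ∀ x ∈ i.1.1, x ∈ W ∧ col x = i.2 (c i.1 x) := fun x hx =>
        hW ⟨x, i.2 (c i.1 x)⟩ (mem_coloredEdge.2 ⟨hx, rfl⟩)
      refine ⟨i.1.1, Multiset.coe_mem, fun x hx => (hcol x hx).1, fun x hx y hy hxy => ?_⟩
      rw [(hcol x hx).2, (hcol y hy).2] at hxy
      exact hc i.1 hx hy (i.2.injective hxy)
  have hε : 1 - min 1 (2 / (Nat.sqrt (Nat.log 2 r + 1) : ℝ)) ≤ 1 - missProb (p / k) (univ.image h) :=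
    sub_le_sub_left (le_min (missProb_le_one (by positivity) ((div_le_one hk').2 (by linarith)) _)
      hmiss) 1
  exact hε.trans hrainbow
end
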